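/- For i ∈ {h,v} let Ψ^{(i)} ∈ W₂^q, let ℰ_j be a standard edge fragment, let R_γ be the rotation matrix by an angle γ ∈ [0, 2π), and let r ∈ ℕ₀² be a multi-index. Then for even j ≥ 10 and |ℓ| ≤ 2^{j/2} there is a constant C(r) > 0 such that ∫_{supp Ψ_{j,ℓ}^{(i)}} |∂^r[𝓕ℰ_j](R_γᵀ ξ)|² dξ ≤ C(r) · 2^{−j(3/2 + |r|₁)} · (1 + 2^{j/2}|sin(θ_{j,ℓ}^{(i)} − γ)|)^{−5}. -/

import Mathlib

open Real MeasureTheory Set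
open scoped Classical

noncomputable section

/-- A window function `g ∈ 𝒲`: nonnegative, even, with support `(-2/3, 2/3)`,
and whose integer translates form a partition of unity. -/
structure IsWindow (g : ℝ → ℝ) : Prop where
  nonneg : ∀ x, 0 ≤ g x
  even_fun : ∀ x, g (-x) = g x
  supp_eq : Function.support g = Ioo (-(2/3) : ℝ) (2/3)
  partition : ∀ x : ℝ, HasSum (fun z : ℤ => g (x + (z : ℝ))) 1

/-- `g ∈ 𝒲^q`: a window function that is `q`-times continuously differentiable. -/
def IsWindowQ (g : ℝ → ℝ) (q : ℕ) : Prop := IsWindow g ∧ ContDiff ℝ q g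

/-- `g̃(x) = g(x/2) - g(x)`. -/
def gtilde (g : ℝ → ℝ) : ℝ → ℝ := fun x => g (x / 2) - g x

/-- Horizontal bivariate window `Ψ^{(h)}(x) = g̃(x₁) g(x₂)`. -/
def PsiH (g : ℝ → ℝ) : ℝ × ℝ → ℝ := fun x => gtilde g x.1 * g x.2

/-- Vertical bivariate window `Ψ^{(v)}(x) = g(x₁) g̃(x₂)`. -/
def PsiV (g : ℝ → ℝ) : ℝ × ℝ → ℝ := fun x => g x.1 * gtilde g x.2

/-- `Ψ_{j,ℓ}^{(i)}(ξ) = Ψ^{(i)}((N_{j,ℓ}^{(i)})^{-T} ξ)`, where the inverse transpose of the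
shear matrices has been written out explicitly.  `i = true` is the horizontal case `(h)`,
`i = false` the vertical case `(v)`. -/
def PsiJL (g : ℝ → ℝ) (i : Bool) (j : ℕ) (ℓ : ℤ) : ℝ × ℝ → ℝ := fun ξ =>
  if i then
    PsiH g ((2:ℝ) ^ (-(j:ℝ)) * ξ.1,
            (2:ℝ) ^ (-(j:ℝ)/2) * ξ.2 - (ℓ:ℝ) * (2:ℝ) ^ (-(j:ℝ)) * ξ.1)
  else
    PsiV g ((2:ℝ) ^ (-(j:ℝ)/2) * ξ.1 - (ℓ:ℝ) * (2:ℝ) ^ (-(j:ℝ)) * ξ.2,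
            (2:ℝ) ^ (-(j:ℝ)) * ξ.2)

/-- Discrete angles `θ_{j,ℓ}^{(h)} = arctan(ℓ 2^{-j/2})`,
`θ_{j,ℓ}^{(v)} = arccot(ℓ 2^{-j/2}) = π/2 - arctan(ℓ 2^{-j/2})`. -/
def thetaJL (i : Bool) (j : ℕ) (ℓ : ℤ) : ℝ :=
  if i then arctan ((ℓ:ℝ) * (2:ℝ) ^ (-(j:ℝ)/2))
  else π/2 - arctan ((ℓ:ℝ) * (2:ℝ) ^ (-(j:ℝ)/2))

/-- The pattern `𝒫(N_{j,ℓ}^{(i)}) = (N_{j,ℓ}^{(i)})^{-1} ℤ² ∩ [-1/2,1/2)²`: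
`y` belongs to the pattern iff `N_{j,ℓ}^{(i)} y ∈ ℤ²` and `y ∈ [-1/2,1/2)²`. -/
def pattern (i : Bool) (j : ℕ) (ℓ : ℤ) : Set (ℝ × ℝ) :=
  {y : ℝ × ℝ |
    (∃ k : ℤ × ℤ,
      (if i then ((2:ℝ)^(j:ℝ) * y.1 + (ℓ:ℝ) * (2:ℝ)^((j:ℝ)/2) * y.2, (2:ℝ)^((j:ℝ)/2) * y.2)
       else ((2:ℝ)^((j:ℝ)/2) * y.1, (ℓ:ℝ) * (2:ℝ)^((j:ℝ)/2) * y.1 + (2:ℝ)^(j:ℝ) * y.2))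
        = ((k.1 : ℝ), (k.2 : ℝ)))
    ∧ y.1 ∈ Ico (-(1/2) : ℝ) (1/2) ∧ y.2 ∈ Ico (-(1/2) : ℝ) (1/2)}

/-- `ỹ = y - (2^{-j-1},0)ᵀ` in the horizontal case, `ỹ = y - (0,2^{-j-1})ᵀ` in the vertical one. -/
def ytilde (i : Bool) (j : ℕ) (y : ℝ × ℝ) : ℝ × ℝ :=
  if i then (y.1 - (2:ℝ) ^ (-(j:ℝ) - 1), y.2) else (y.1, y.2 - (2:ℝ) ^ (-(j:ℝ) - 1))

/-- The trigonometric polynomial shearlet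
`ψ_{j,ℓ,y}^{(i)}(x) = ∑_{k∈ℤ²} Ψ_{j,ℓ}^{(i)}(k) e^{i k·(x - 2πỹ)}`. -/
def shearlet (g : ℝ → ℝ) (i : Bool) (j : ℕ) (ℓ : ℤ) (y : ℝ × ℝ) : ℝ × ℝ → ℂ := fun x =>
  ∑' k : ℤ × ℤ, (PsiJL g i j ℓ ((k.1 : ℝ), (k.2 : ℝ)) : ℂ) *
    Complex.exp (Complex.I *
      (((k.1 : ℝ) * (x.1 - 2*π*(ytilde i j y).1)
        + (k.2 : ℝ) * (x.2 - 2*π*(ytilde i j y).2) : ℝ) : ℂ))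

/-- `⟨f,h⟩₂ = (2π)^{-2} ∫_{𝕋²} f(x) conj(h(x)) dx`, with the torus realised as `[-π,π]²`. -/
def inner2 (f h : ℝ × ℝ → ℂ) : ℂ :=
  ((2*π)^2 : ℂ)⁻¹ * ∫ x in (Icc (-π) π ×ˢ Icc (-π) π : Set (ℝ × ℝ)), f x * (starRingEnd ℂ) (h x)

/-- The `2π`-periodization `f^{2π} = ∑_{n∈ℤ²} f(· + 2πn)`. -/
def periodize (f : ℝ × ℝ → ℝ) : ℝ × ℝ → ℝ := fun x =>
  ∑' n : ℤ × ℤ, f (x.1 + 2*π*(n.1 : ℝ), x.2 + 2*π*(n.2 : ℝ))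

/-- Euclidean norm `|x|₂` on `ℝ²`. -/
def nrm2 (x : ℝ × ℝ) : ℝ := Real.sqrt (x.1^2 + x.2^2)

/-- First partial derivative of a complex-valued function of two real variables. -/
def pd1 (f : ℝ × ℝ → ℂ) : ℝ × ℝ → ℂ := fun x => deriv (fun t => f (t, x.2)) x.1

/-- Second partial derivative of a complex-valued function of two real variables. -/
def pd2 (f : ℝ × ℝ → ℂ) : ℝ × ℝ → ℂ := fun x => deriv (fun t => f (x.1, t)) x.2

/-- `∂^r = ∂^{r₁+r₂}/∂x₁^{r₁}∂x₂^{r₂}` (complex-valued). -/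
def pd (r : ℕ × ℕ) (f : ℝ × ℝ → ℂ) : ℝ × ℝ → ℂ := pd1^[r.1] (pd2^[r.2] f)

/-- First partial derivative of a real-valued function of two real variables. -/
def pdR1 (f : ℝ × ℝ → ℝ) : ℝ × ℝ → ℝ := fun x => deriv (fun t => f (t, x.2)) x.1

/-- Second partial derivative of a real-valued function of two real variables. -/
def pdR2 (f : ℝ × ℝ → ℝ) : ℝ × ℝ → ℝ := fun x => deriv (fun t => f (x.1, t)) x.2

/-- `∂^r = ∂^{r₁+r₂}/∂x₁^{r₁}∂x₂^{r₂}` (real-valued). -/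
def pdR (r : ℕ × ℕ) (f : ℝ × ℝ → ℝ) : ℝ × ℝ → ℝ := pdR1^[r.1] (pdR2^[r.2] f)

/-- The Fourier transform `𝓕f(x) = (2π)^{-2} ∫_{ℝ²} f(ξ) e^{-iξ·x} dξ`. -/
def FT (f : ℝ × ℝ → ℂ) : ℝ × ℝ → ℂ := fun x =>
  ((2*π)^2 : ℂ)⁻¹ * ∫ ξ : ℝ × ℝ, f ξ * Complex.exp (-(Complex.I) * ((ξ.1*x.1 + ξ.2*x.2 : ℝ) : ℂ))

/-- Rotation matrix `R_γ` acting on `ℝ²`. -/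
def rotM (γ : ℝ) (x : ℝ × ℝ) : ℝ × ℝ :=
  (Real.cos γ * x.1 - Real.sin γ * x.2, Real.sin γ * x.1 + Real.cos γ * x.2)

/-- Transposed rotation matrix `R_γᵀ` acting on `ℝ²`. -/
def rotT (γ : ℝ) (x : ℝ × ℝ) : ℝ × ℝ :=
  (Real.cos γ * x.1 + Real.sin γ * x.2, -(Real.sin γ) * x.1 + Real.cos γ * x.2)

/-- The standard edge fragment `ℰ_j(x) = f(x) φ(2^{j/2}x) χ_{{x₁ ≥ E(x₂)}}(x)`. -/
def edgeFragment (f φ : ℝ × ℝ → ℝ) (E : ℝ → ℝ) (j : ℕ) : ℝ × ℝ → ℝ := fun x =>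
  f x * φ ((2:ℝ)^((j:ℝ)/2) * x.1, (2:ℝ)^((j:ℝ)/2) * x.2) * (if E x.2 ≤ x.1 then 1 else 0)

/-- The second-order differential operator `L = I + 2^j Δ`. -/
def Lop (j : ℕ) (f : ℝ × ℝ → ℂ) : ℝ × ℝ → ℂ := fun x =>
  f x + (Complex.ofReal ((2:ℝ)^(j:ℝ))) * (pd (2,0) f x + pd (0,2) f x)

/-- The dyadic square `Q` indexed by `(n₁,n₂)` at scale `j`. -/
def dyadicSquare (j : ℕ) (n : ℕ × ℕ) : Set (ℝ × ℝ) :=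
  Ico (2*π*(n.1:ℝ)*(2:ℝ)^(-(j:ℝ)/2) - π) (2*π*((n.1:ℝ)+1)*(2:ℝ)^(-(j:ℝ)/2) - π) ×ˢ
  Ico (2*π*(n.2:ℝ)*(2:ℝ)^(-(j:ℝ)/2) - π) (2*π*((n.2:ℝ)+1)*(2:ℝ)^(-(j:ℝ)/2) - π)

/-- The indices of the dyadic squares at scale `j` meeting `∂T` (the set `𝒬_j^1`). -/
def Q1set (T : Set (ℝ × ℝ)) (j : ℕ) : Finset (ℕ × ℕ) :=
  (Finset.range (2^(j/2)) ×ˢ Finset.range (2^(j/2))).filter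
    (fun n => (frontier T ∩ dyadicSquare j n).Nonempty)

/-- Fresnel integral `Fc(x) = ∫₀ˣ cos v/√v dv`. -/
def Fc (x : ℝ) : ℝ := ∫ v in (0:ℝ)..x, Real.cos v / Real.sqrt v

/-- Fresnel integral `Fs(x) = ∫₀ˣ sin v/√v dv`. -/
def Fs (x : ℝ) : ℝ := ∫ v in (0:ℝ)..x, Real.sin v / Real.sqrt v

/-- `F⁺ = Fc + Fs`. -/
def Fp (x : ℝ) : ℝ := Fc x + Fs x

/-- `F⁻ = Fc - Fs`. -/
def Fm (x : ℝ) : ℝ := Fc x - Fs x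

/-- `a(λ,p,A)` of the paper. -/
def aInt (g : ℝ → ℝ) (l p A : ℝ) : ℝ :=
  ∫ v in Ioi (0:ℝ),
    (g (2*Real.sqrt (A*l*v) + p*l) + g (2*Real.sqrt (A*l*v) - p*l)) * (Real.cos v / Real.sqrt v)

/-- `b(λ,p,A)` of the paper. -/
def bInt (g : ℝ → ℝ) (l p A : ℝ) : ℝ :=
  ∫ v in Ioi (0:ℝ),
    (g (2*Real.sqrt (A*l*v) + p*l) + g (2*Real.sqrt (A*l*v) - p*l)) * (Real.sin v / Real.sqrt v)

/-- `P₁(D,p,A)` of the paper. -/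
def P1 (g : ℝ → ℝ) (D p A : ℝ) : ℝ :=
  ∫ l in (1/3 : ℝ)..(4/3),
    gtilde g l * l⁻¹ *
      ((aInt g l p A + bInt g l p A) * Real.cos (D*l)
        + (aInt g l p A - bInt g l p A) * Real.sin (D*l))

/-- `P₂(D,p,A)` of the paper. -/
def P2 (g : ℝ → ℝ) (D p A : ℝ) : ℝ :=
  ∫ l in (1/3 : ℝ)..(4/3),
    gtilde g l * l⁻¹ *
      ((aInt g l p A + bInt g l p A) * Real.sin (D*l)
        - (aInt g l p A - bInt g l p A) * Real.cos (D*l))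

/-- The oscillatory integral `∫_{-4}^{4} κ(w) e^{-i t a(w)} dw`. -/
def oscInt (a : ℝ → ℝ) (κ : ℝ → ℂ) (t : ℝ) : ℂ :=
  ∫ w in Icc (-4 : ℝ) 4, κ w * Complex.exp (-(Complex.I * ((t * a w : ℝ) : ℂ)))

lemma norm_exp_neg_I_mul (x : ℝ) : ‖Complex.exp (-(Complex.I * (x : ℂ)))‖ = 1 := by
  rw [← mul_neg, ← Complex.ofReal_neg, mul_comm]
  exact Complex.norm_exp_ofReal_mul_I _

lemma oscInt_congr {a : ℝ → ℝ} {κ κ₁ : ℝ → ℂ} (h : EqOn κ κ₁ (Icc (-4) 4)) (t : ℝ) :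
    oscInt a κ t = oscInt a κ₁ t :=
  setIntegral_congr_fun measurableSet_Icc fun w hw => by simp only [h hw]

lemma continuous_oscInt {a : ℝ → ℝ} {κ : ℝ → ℂ} (hκ : ContinuousOn κ (Icc (-4) 4))
    (ha : Continuous a) : Continuous (oscInt a κ) := by
  refine continuous_of_dominated (bound := fun w => ‖κ w‖) (fun t => ?_) (fun t => ?_) ?_ ?_
  · exact (hκ.mul (by fun_prop)).aestronglyMeasurable measurableSet_Icc
  · refine Filter.Eventually.of_forall fun w => ?_
    rw [norm_mul, norm_exp_neg_I_mul, mul_one]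
  · exact (hκ.integrableOn_compact isCompact_Icc).norm
  · refine Filter.Eventually.of_forall fun w => ?_
    fun_prop

lemma norm_oscInt_le {a : ℝ → ℝ} {κ : ℝ → ℂ} {M : ℝ} (hM : ∀ w ∈ Icc (-4 : ℝ) 4, ‖κ w‖ ≤ M)
    (t : ℝ) : ‖oscInt a κ t‖ ≤ 8 * M := by
  have h := norm_setIntegral_le_of_norm_le_const (μ := volume) (s := Icc (-4 : ℝ) 4)
    (f := fun w => κ w * Complex.exp (-(Complex.I * ((t * a w : ℝ) : ℂ)))) (C := M)
    (by simp) (fun w hw => by rw [norm_mul, norm_exp_neg_I_mul, mul_one]; exact hM w hw)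
  refine h.trans (le_of_eq ?_)
  simp [Measure.real]
  norm_num
  ring

/-- Gaussian-weighted Fourier transform, evaluated at a real frequency. -/
lemma norm_integral_gaussian_mul_exp {b : ℝ} (hb : 0 < b) (x : ℝ) :
    ‖∫ t : ℝ, (Real.exp (-b * t ^ 2) : ℂ) * Complex.exp (-(Complex.I * ((t * x : ℝ) : ℂ)))‖
      = √(π / b) * Real.exp (-x ^ 2 / (4 * b)) := by
  have h := fourierIntegral_gaussian (b := (b : ℂ)) (by simpa using hb) ((-x : ℝ) : ℂ)
  have h2 : (∫ t : ℝ, (Real.exp (-b * t ^ 2) : ℂ) *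
      Complex.exp (-(Complex.I * ((t * x : ℝ) : ℂ)))) =
      ((√(π / b) * Real.exp (-x ^ 2 / (4 * b)) : ℝ) : ℂ) := by
    rw [Real.sqrt_eq_rpow]
    push_cast
    rw [Complex.ofReal_cpow (by positivity)]
    push_cast
    refine Eq.trans ?_ (h.trans ?_)
    · congr 1
      funext t
      rw [mul_comm]
      congr 2
      push_cast
      ring
    · push_cast
      congr 2
      ring_nf
  rw [h2, Complex.norm_real, Real.norm_of_nonneg (by positivity)]

/-- An `L²` bound for oscillatory integrals whose phase function is expanding. -/
lemma setIntegral_norm_oscInt_sq_le {a : ℝ → ℝ} {κ : ℝ → ℂ} {M m R : ℝ}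
    (hκ : ContinuousOn κ (Icc (-4) 4)) (ha : Continuous a) (hm : 0 < m) (hR : 0 < R)
    (hM : ∀ w ∈ Icc (-4 : ℝ) 4, ‖κ w‖ ≤ M)
    (hsep : ∀ w ∈ Icc (-4 : ℝ) 4, ∀ w' ∈ Icc (-4 : ℝ) 4, m * |w - w'| ≤ |a w - a w'|) :
    ∫ t in Icc (-R) R, ‖oscInt a κ t‖ ^ 2 ≤ 200 * M ^ 2 / m := by
  have hM0 : 0 ≤ M := (norm_nonneg _).trans (hM 0 (by norm_num))
  set b : ℝ := 1 / R ^ 2 with hb_def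
  have hb : 0 < b := by positivity
  set μ : Measure ℝ := volume.restrict (Icc (-4 : ℝ) 4) with hμ
  have hcont := continuous_oscInt hκ ha
  set G : ℝ → ℝ := fun t => Real.exp (-b * t ^ 2) with hG
  have hGi : Integrable G := integrable_exp_neg_mul_sq hb
  have hGT : Integrable fun t => G t * ‖oscInt a κ t‖ ^ 2 := by
    refine hGi.mul_bdd (c := (8 * M) ^ 2) (by fun_prop) ?_
    refine Filter.Eventually.of_forall fun t => ?_
    rw [norm_pow, norm_norm]
    gcongr
    exact norm_oscInt_le hM t
  have step1 : ∫ t in Icc (-R) R, ‖oscInt a κ t‖ ^ 2 ≤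
      Real.exp 1 * ∫ t, G t * ‖oscInt a κ t‖ ^ 2 := by
    rw [← integral_const_mul]
    refine le_trans ?_ (setIntegral_le_integral (s := Icc (-R) R) (hGT.const_mul _)
      (Filter.Eventually.of_forall fun t => by positivity))
    refine setIntegral_mono_on ?_ (hGT.const_mul _).integrableOn measurableSet_Icc ?_
    · exact (by fun_prop : Continuous fun t => ‖oscInt a κ t‖ ^ 2).integrableOn_Icc
    · intro t ht
      rw [← mul_assoc, hG, ← Real.exp_add]
      refine le_mul_of_one_le_left (by positivity) (Real.one_le_exp ?_)
      have : t ^ 2 ≤ R ^ 2 := sq_le_sq' ht.1 ht.2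
      have : b * t ^ 2 ≤ 1 := by
        rw [hb_def, one_div_mul_eq_div, div_le_one (by positivity)]; exact this
      linarith
  set F : ℝ → ℝ × ℝ → ℂ := fun t z =>
    (G t : ℂ) * (κ z.1 * (starRingEnd ℂ) (κ z.2) *
      Complex.exp (-(Complex.I * ((t * (a z.1 - a z.2) : ℝ) : ℂ)))) with hF
  have hsq : ∀ t, ((G t * ‖oscInt a κ t‖ ^ 2 : ℝ) : ℂ) = ∫ z, F t z ∂(μ.prod μ) := by
    intro t
    rw [hF]
    simp only
    rw [integral_const_mul]
    push_cast
    congr 1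
    rw [← Complex.mul_conj', oscInt, ← integral_conj, ← integral_prod_mul]
    congr 1
    funext z
    rw [map_mul, ← Complex.exp_conj]
    simp only [map_neg, map_mul, Complex.conj_I, Complex.conj_ofReal]
    have : Complex.exp (-(Complex.I * ((t * (a z.1 - a z.2) : ℝ) : ℂ))) =
        Complex.exp (-(Complex.I * ((t * a z.1 : ℝ) : ℂ))) *
          Complex.exp (-(-Complex.I * ((t * a z.2 : ℝ) : ℂ))) := by
      rw [← Complex.exp_add]; congr 1; push_cast; ring
    push_cast at this ⊢
    rw [this]; ring
  have hμ2 : μ.prod μ = (volume : Measure (ℝ × ℝ)).restrict (Icc (-4) 4 ×ˢ Icc (-4) 4) := by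
    rw [hμ, Measure.prod_restrict]; rfl
  have hκ2 : AEStronglyMeasurable (fun z : ℝ × ℝ => κ z.1 * (starRingEnd ℂ) (κ z.2))
      (μ.prod μ) := by
    rw [hμ2]
    refine ContinuousOn.aestronglyMeasurable ?_ (measurableSet_Icc.prod measurableSet_Icc)
    refine (hκ.comp continuousOn_fst fun z hz => hz.1).mul ?_
    exact Complex.continuous_conj.comp_continuousOn
      (hκ.comp continuousOn_snd fun z hz => hz.2)
  have hz : ∀ᵐ z ∂(μ.prod μ), z.1 ∈ Icc (-4 : ℝ) 4 ∧ z.2 ∈ Icc (-4 : ℝ) 4 := by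
    rw [hμ2]
    exact ae_restrict_mem (measurableSet_Icc.prod measurableSet_Icc)
  have hFi : Integrable (Function.uncurry F) (volume.prod (μ.prod μ)) := by
    have h1 : Integrable (fun x : ℝ × (ℝ × ℝ) => (G x.1 : ℂ) * ((M ^ 2 : ℝ) : ℂ))
        (volume.prod (μ.prod μ)) :=
      Integrable.mul_prod (f := fun t => (G t : ℂ)) (g := fun _ : ℝ × ℝ => ((M ^ 2 : ℝ) : ℂ))
        hGi.ofReal (integrable_const _)
    refine h1.mono ?_ ?_
    · refine AEStronglyMeasurable.mul (by fun_prop) (hκ2.comp_snd.mul (by fun_prop))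
    · filter_upwards [Measure.quasiMeasurePreserving_snd.ae hz] with x hx
      simp only [Function.uncurry, hF, norm_mul, norm_exp_neg_I_mul, mul_one, RCLike.norm_conj,
        Complex.norm_real, norm_pow, Real.norm_of_nonneg hM0]
      rw [sq]
      gcongr
      · exact hM _ hx.1
      · exact hM _ hx.2
  have hinner : ∀ᵐ z ∂(μ.prod μ), ‖∫ t, F t z‖ ≤
      M ^ 2 * (√(π / b) * Real.exp (-(m ^ 2 / (4 * b)) * (z.1 - z.2) ^ 2)) := by
    filter_upwards [hz] with z hz
    have : (∫ t, F t z) = κ z.1 * (starRingEnd ℂ) (κ z.2) * ∫ t : ℝ, (G t : ℂ) *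
        Complex.exp (-(Complex.I * ((t * (a z.1 - a z.2) : ℝ) : ℂ))) := by
      rw [← integral_const_mul]
      congr 1
      funext t
      rw [hF]; ring
    rw [this, norm_mul, norm_mul, RCLike.norm_conj, norm_integral_gaussian_mul_exp hb, sq M]
    gcongr
    · exact hM _ hz.1
    · exact hM _ hz.2
    · have h1 := hsep _ hz.1 _ hz.2
      have h2 : (m * |z.1 - z.2|) ^ 2 ≤ |a z.1 - a z.2| ^ 2 := by gcongr
      rw [mul_pow, sq_abs, sq_abs] at h2
      rw [neg_mul, neg_div, neg_le_neg_iff, div_mul_eq_mul_div]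
      gcongr
  set c : ℝ := m ^ 2 / (4 * b) with hc
  have hcpos : 0 < c := by positivity
  have hbd_int : Integrable (fun z : ℝ × ℝ =>
      M ^ 2 * (√(π / b) * Real.exp (-c * (z.1 - z.2) ^ 2))) (μ.prod μ) := by
    rw [hμ2]
    exact (by fun_prop : Continuous fun z : ℝ × ℝ =>
      M ^ 2 * (√(π / b) * Real.exp (-c * (z.1 - z.2) ^ 2))).continuousOn.integrableOn_compact
        (isCompact_Icc.prod isCompact_Icc)
  have step2 : ∫ t, G t * ‖oscInt a κ t‖ ^ 2 ≤
      ∫ z, M ^ 2 * (√(π / b) * Real.exp (-c * (z.1 - z.2) ^ 2)) ∂(μ.prod μ) := by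
    have e1 : ((∫ t, G t * ‖oscInt a κ t‖ ^ 2 : ℝ) : ℂ) = ∫ z, (∫ t, F t z) ∂(μ.prod μ) := by
      rw [← integral_complex_ofReal, ← integral_integral_swap hFi]
      congr 1
      funext t
      exact hsq t
    have e2 := norm_integral_le_of_norm_le hbd_int hinner
    rw [← e1, Complex.norm_real] at e2
    exact (le_abs_self _).trans e2
  have step3 : ∫ z, M ^ 2 * (√(π / b) * Real.exp (-c * (z.1 - z.2) ^ 2)) ∂(μ.prod μ) ≤
      8 * (M ^ 2 * (√(π / b) * √(π / c))) := by
    rw [integral_prod _ hbd_int]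
    have hle : ∀ x : ℝ, (∫ y, M ^ 2 * (√(π / b) * Real.exp (-c * (x - y) ^ 2)) ∂μ) ≤
        M ^ 2 * (√(π / b) * √(π / c)) := by
      intro x
      rw [integral_const_mul, integral_const_mul]
      gcongr
      have hi : Integrable fun y : ℝ => Real.exp (-c * (x - y) ^ 2) :=
        (integrable_exp_neg_mul_sq hcpos).comp_sub_left x
      refine (setIntegral_le_integral hi
        (Filter.Eventually.of_forall fun t => by positivity)).trans (le_of_eq ?_)
      rw [integral_sub_left_eq_self (fun y : ℝ => Real.exp (-c * y ^ 2)) volume x,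
        integral_gaussian]
    refine (integral_mono hbd_int.integral_prod_left (integrable_const _) hle).trans
      (le_of_eq ?_)
    rw [integral_const]
    simp [hμ, Measure.real]
    norm_num
  have hval : √(π / b) * √(π / c) = 2 * π / m := by
    rw [← Real.sqrt_mul (by positivity), hc]
    have : π / b * (π / (m ^ 2 / (4 * b))) = (2 * π / m) ^ 2 := by
      field_simp
      ring
    rw [this, Real.sqrt_sq (by positivity)]
  rw [hval] at step3
  calc _ ≤ Real.exp 1 * (8 * (M ^ 2 * (2 * π / m))) :=
        step1.trans (by gcongr; exact step2.trans step3)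
    _ = (16 * Real.exp 1 * π) * M ^ 2 / m := by ring
    _ ≤ 200 * M ^ 2 / m := by
        gcongr
        have h1 := Real.exp_one_lt_d9
        have h2 := Real.pi_lt_d2
        have h3 := Real.pi_pos
        nlinarith

/-- The set of radial frequencies `N/3 ≤ |t| ≤ 4N/3`. -/
def band (N : ℝ) : Set ℝ := {t | N / 3 ≤ |t| ∧ |t| ≤ 4 * N / 3}

lemma isCompact_band (N : ℝ) : IsCompact (band N) := by
  refine (isCompact_Icc (a := -(4 * N / 3)) (b := 4 * N / 3)).of_isClosed_subset ?_ ?_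
  · exact (isClosed_le continuous_const continuous_abs).inter
      (isClosed_le continuous_abs continuous_const)
  · intro t ht
    exact abs_le.1 ht.2

lemma measurableSet_band (N : ℝ) : MeasurableSet (band N) := (isCompact_band N).measurableSet

lemma band_subset (N : ℝ) : band N ⊆ Icc (-(4 * N / 3)) (4 * N / 3) := fun _ ht => abs_le.1 ht.2

lemma integrableOn_band_norm_sq {F : ℝ → ℂ} (hF : Continuous F) (N : ℝ) :
    IntegrableOn (fun t => ‖F t‖ ^ 2) (band N) :=
  (by fun_prop : Continuous fun t => ‖F t‖ ^ 2).continuousOn.integrableOn_compact (isCompact_band N)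

/-- A phase function `a` with `a' = P b`, where `b ≥ 1/2` and `|b'| ≤ B` on `[-4,4]`. -/
structure IsPhase (a b b' : ℝ → ℝ) (P B : ℝ) : Prop where
  deriv_phase : ∀ w, HasDerivAt a (P * b w) w
  deriv_slope : ∀ w, HasDerivAt b (b' w) w
  cont : Continuous b'
  lower : ∀ w ∈ Icc (-4 : ℝ) 4, 1 / 2 ≤ b w
  upper : ∀ w ∈ Icc (-4 : ℝ) 4, |b' w| ≤ B
  ne_zero : P ≠ 0

namespace IsPhase

variable {a b b' : ℝ → ℝ} {P B : ℝ}

lemma continuous_phase (h : IsPhase a b b' P B) : Continuous a :=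
  continuous_iff_continuousAt.2 fun w => (h.deriv_phase w).continuousAt

lemma continuous_slope (h : IsPhase a b b' P B) : Continuous b :=
  continuous_iff_continuousAt.2 fun w => (h.deriv_slope w).continuousAt

lemma slope_ne_zero (h : IsPhase a b b' P B) {w : ℝ} (hw : w ∈ Icc (-4 : ℝ) 4) : b w ≠ 0 := by
  have := h.lower w hw
  intro h0
  norm_num [h0] at this

lemma bound_nonneg (h : IsPhase a b b' P B) : 0 ≤ B :=
  (abs_nonneg _).trans (h.upper 0 (by norm_num))

lemma separation (h : IsPhase a b b' P B) {w w' : ℝ} (hw : w ∈ Icc (-4 : ℝ) 4)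
    (hw' : w' ∈ Icc (-4 : ℝ) 4) : |P| / 2 * |w - w'| ≤ |a w - a w'| := by
  have hd : ∀ w, HasDerivAt (fun w => a w / P) (b w) w := fun w => by
    have := (h.deriv_phase w).div_const P
    rwa [mul_div_cancel_left₀ _ h.ne_zero] at this
  have key : ∀ x ∈ Icc (-4 : ℝ) 4, ∀ y ∈ Icc (-4 : ℝ) 4, x ≤ y →
      1 / 2 * (y - x) ≤ a y / P - a x / P := by
    refine Convex.mul_sub_le_image_sub_of_le_deriv (convex_Icc _ _)
      (fun w _ => (hd w).continuousAt.continuousWithinAt)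
      (fun w _ => (hd w).differentiableAt.differentiableWithinAt) ?_
    intro w hw
    rw [(hd w).deriv]
    exact h.lower w (interior_subset hw)
  have key2 : 1 / 2 * |w - w'| ≤ |a w / P - a w' / P| := by
    rcases le_total w w' with hle | hle
    · have := key w hw w' hw' hle
      rw [abs_sub_comm, abs_of_nonneg (sub_nonneg.2 hle), abs_sub_comm]
      exact this.trans (le_abs_self _)
    · have := key w' hw' w hw hle
      rw [abs_of_nonneg (sub_nonneg.2 hle)]
      exact this.trans (le_abs_self _)
  rw [← sub_div, abs_div, le_div_iff₀ (abs_pos.2 h.ne_zero)] at key2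
  linarith

lemma setIntegral_band_le (h : IsPhase a b b' P B) {κ : ℝ → ℂ} {M N : ℝ} (hN : 0 < N)
    (hκ : ContinuousOn κ (Icc (-4) 4)) (hM : ∀ w ∈ Icc (-4 : ℝ) 4, ‖κ w‖ ≤ M) :
    ∫ t in band N, ‖oscInt a κ t‖ ^ 2 ≤ 400 * M ^ 2 / |P| := by
  have hP := abs_pos.2 h.ne_zero
  have h1 := setIntegral_norm_oscInt_sq_le (R := 4 * N / 3) (m := |P| / 2) hκ h.continuous_phase
    (by positivity) (by positivity) hM (fun w hw w' hw' => h.separation hw hw')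
  refine (setIntegral_mono_set ?_ (Filter.Eventually.of_forall fun t => by positivity)
    (band_subset N).eventuallyLE).trans (h1.trans (le_of_eq ?_))
  · have := continuous_oscInt hκ h.continuous_phase
    exact (by fun_prop : Continuous fun t => ‖oscInt a κ t‖ ^ 2).integrableOn_Icc
  · field_simp
    ring

lemma oscInt_mul_slope (h : IsPhase a b b' P B) {G G' : ℝ → ℂ}
    (hG : ∀ w ∈ Icc (-4 : ℝ) 4, HasDerivAt G (G' w) w) (hG' : ContinuousOn G' (Icc (-4) 4))
    (h0 : G (-4) = 0) (h1 : G 4 = 0) (t : ℝ) :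
    Complex.I * ((t * P : ℝ) : ℂ) * oscInt a (fun w => (b w : ℂ) * G w) t = oscInt a G' t := by
  have hc1 : ContinuousOn G (Icc (-4) 4) := fun w hw => (hG w hw).continuousAt.continuousWithinAt
  have hca := h.continuous_phase
  have hcb := h.continuous_slope
  set e : ℝ → ℂ := fun w => Complex.exp (-(Complex.I * ((t * a w : ℝ) : ℂ))) with he
  have hce : Continuous e := by fun_prop
  have hde : ∀ w, HasDerivAt e (e w * (-(Complex.I * ((t * (P * b w) : ℝ) : ℂ)))) w := by
    intro w
    exact ((((h.deriv_phase w).const_mul t).ofReal_comp).const_mul Complex.I).neg.cexp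
  have hftc := intervalIntegral.integral_eq_sub_of_hasDerivAt (a := -4) (b := 4)
    (f := fun w => G w * e w)
    (f' := fun w => G' w * e w + G w * (e w * (-(Complex.I * ((t * (P * b w) : ℝ) : ℂ)))))
    (fun w hw => by
      rw [uIcc_of_le (by norm_num)] at hw
      exact (hG w hw).mul (hde w))
    (by
      refine ContinuousOn.intervalIntegrable ?_
      rw [uIcc_of_le (by norm_num)]
      fun_prop)
  simp only [h0, h1, zero_mul, sub_zero] at hftc
  rw [intervalIntegral.integral_of_le (by norm_num), ← integral_Icc_eq_integral_Ioc,
    integral_add] at hftc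
  · have h3 : oscInt a G' t = ∫ w in Icc (-4 : ℝ) 4, G' w * e w := rfl
    rw [h3, eq_neg_of_add_eq_zero_left hftc, oscInt, ← integral_const_mul, ← integral_neg]
    congr 1
    funext w
    simp only [he]
    push_cast
    ring
  · exact (hG'.mul hce.continuousOn).integrableOn_compact isCompact_Icc
  · refine ContinuousOn.integrableOn_compact isCompact_Icc ?_
    fun_prop

lemma oscInt_eq_oscInt_deriv_div (h : IsPhase a b b' P B) {κ κ' : ℝ → ℂ}
    (hκ : ∀ w ∈ Icc (-4 : ℝ) 4, HasDerivAt κ (κ' w) w) (hκ' : ContinuousOn κ' (Icc (-4) 4))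
    (h0 : κ (-4) = 0) (h1 : κ 4 = 0) (t : ℝ) :
    Complex.I * ((t * P : ℝ) : ℂ) * oscInt a κ t =
      oscInt a (fun w => κ' w / b w - κ w * b' w / (b w : ℂ) ^ 2) t := by
  have hne : ∀ w ∈ Icc (-4 : ℝ) 4, (b w : ℂ) ≠ 0 := fun w hw => by
    exact_mod_cast h.slope_ne_zero hw
  have hcκ : ContinuousOn κ (Icc (-4) 4) := fun w hw => (hκ w hw).continuousAt.continuousWithinAt
  have hcb : ContinuousOn (fun w => (b w : ℂ)) (Icc (-4) 4) :=
    (Complex.continuous_ofReal.comp h.continuous_slope).continuousOn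
  have hcb' : ContinuousOn (fun w => (b' w : ℂ)) (Icc (-4) 4) :=
    (Complex.continuous_ofReal.comp h.cont).continuousOn
  have key := h.oscInt_mul_slope (G := fun w => κ w / b w)
    (G' := fun w => κ' w / b w - κ w * b' w / (b w : ℂ) ^ 2) (fun w hw => ?_) ?_
    (by simp [h0]) (by simp [h1]) t
  · rw [← key]
    congr 1
    refine oscInt_congr (fun w hw => ?_) t
    have := hne w hw
    field_simp
  · refine ((hκ w hw).div (h.deriv_slope w).ofReal_comp (hne w hw)).congr_deriv ?_
    have := hne w hw
    field_simp
  · exact (hκ'.div hcb hne).sub ((hcκ.mul hcb').div (hcb.pow 2) fun w hw => pow_ne_zero 2 (hne w hw))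

lemma norm_inv_slope_le (h : IsPhase a b b' P B) {w : ℝ} (hw : w ∈ Icc (-4 : ℝ) 4) :
    ‖(b w : ℂ)⁻¹‖ ≤ 2 := by
  have := h.lower w hw
  rw [norm_inv, Complex.norm_real, Real.norm_of_nonneg (by linarith)]
  exact inv_le_of_inv_le₀ (by norm_num) (by linarith)

lemma norm_slope_deriv_le (h : IsPhase a b b' P B) {w : ℝ} (hw : w ∈ Icc (-4 : ℝ) 4) :
    ‖(b' w : ℂ)‖ ≤ B := by
  rw [Complex.norm_real]; exact h.upper w hw

lemma continuousOn_inv_slope (h : IsPhase a b b' P B) :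
    ContinuousOn (fun w => (b w : ℂ)⁻¹) (Icc (-4) 4) :=
  (Complex.continuous_ofReal.comp h.continuous_slope).continuousOn.inv₀ fun _ hw =>
    Complex.ofReal_ne_zero.2 (h.slope_ne_zero hw)

lemma continuousOn_slope_deriv (h : IsPhase a b b' P B) :
    ContinuousOn (fun w => (b' w : ℂ)) (Icc (-4) 4) :=
  (Complex.continuous_ofReal.comp h.cont).continuousOn

lemma norm_oscInt_le_of_mul (h : IsPhase a b b' P B) {κ : ℝ → ℂ} {N t X : ℝ} (hN : 0 < N)
    (ht : t ∈ band N) (hX : ‖Complex.I * ((t * P : ℝ) : ℂ) * oscInt a κ t‖ ≤ X) :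
    ‖oscInt a κ t‖ ≤ 3 / (N * |P|) * X := by
  have hP := abs_pos.2 h.ne_zero
  rw [norm_mul, norm_mul, Complex.norm_I, one_mul, Complex.norm_real, Real.norm_eq_abs,
    abs_mul] at hX
  have h1 : N / 3 * |P| * ‖oscInt a κ t‖ ≤ X := by
    refine le_trans ?_ hX
    gcongr
    exact ht.1
  calc ‖oscInt a κ t‖ = 3 / (N * |P|) * (N / 3 * |P| * ‖oscInt a κ t‖) := by field_simp
    _ ≤ _ := by gcongr

/-- Decay for once differentiable amplitudes. -/
lemma setIntegral_band_le_of_deriv (h : IsPhase a b b' P B) {κ κ' : ℝ → ℂ} {M N : ℝ} (hN : 0 < N)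
    (hκ : ∀ w ∈ Icc (-4 : ℝ) 4, HasDerivAt κ (κ' w) w) (hκ' : ContinuousOn κ' (Icc (-4) 4))
    (h0 : κ (-4) = 0) (h1 : κ 4 = 0)
    (hM : ∀ w ∈ Icc (-4 : ℝ) 4, ‖κ w‖ ≤ M) (hM' : ∀ w ∈ Icc (-4 : ℝ) 4, ‖κ' w‖ ≤ M) :
    ∫ t in band N, ‖oscInt a κ t‖ ^ 2 ≤
      400 * (2 * M + 4 * (M * B)) ^ 2 / |P| * (3 / (N * |P|)) ^ 2 := by
  have hcκ : ContinuousOn κ (Icc (-4) 4) := fun w hw => (hκ w hw).continuousAt.continuousWithinAt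
  have hM0 : 0 ≤ M := (norm_nonneg _).trans (hM 0 (by norm_num))
  have hB0 := h.bound_nonneg
  have hi := h.continuousOn_inv_slope
  have hb' := h.continuousOn_slope_deriv
  set κ₁ : ℝ → ℂ := fun w => κ' w / b w - κ w * b' w / (b w : ℂ) ^ 2 with hκ₁
  have hc₁ : ContinuousOn κ₁ (Icc (-4) 4) := by
    simp only [hκ₁, div_eq_mul_inv, ← inv_pow]
    fun_prop
  have hb₁ : ∀ w ∈ Icc (-4 : ℝ) 4, ‖κ₁ w‖ ≤ 2 * M + 4 * (M * B) := by
    intro w hw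
    simp only [hκ₁, div_eq_mul_inv, ← inv_pow]
    refine (norm_sub_le _ _).trans ?_
    simp only [norm_mul, norm_pow]
    calc _ ≤ M * 2 + M * B * 2 ^ 2 := by
          gcongr
          exacts [hM' w hw, h.norm_inv_slope_le hw, hM w hw, h.norm_slope_deriv_le hw,
            h.norm_inv_slope_le hw]
      _ = _ := by ring
  refine le_trans ?_ (mul_le_mul_of_nonneg_right (h.setIntegral_band_le hN hc₁ hb₁)
    (sq_nonneg (3 / (N * |P|))))
  rw [← integral_mul_const]
  refine setIntegral_mono_on (integrableOn_band_norm_sq (continuous_oscInt hcκ h.continuous_phase) N)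
    ((integrableOn_band_norm_sq (continuous_oscInt hc₁ h.continuous_phase) N).mul_const _)
    (measurableSet_band N) fun t ht => ?_
  rw [mul_comm, ← mul_pow]
  gcongr
  refine h.norm_oscInt_le_of_mul hN ht (le_of_eq ?_)
  rw [h.oscInt_eq_oscInt_deriv_div hκ hκ' h0 h1]

/-- Decay for twice differentiable amplitudes. -/
lemma setIntegral_band_le_of_deriv_two (h : IsPhase a b b' P B) {κ κ' κ'' : ℝ → ℂ} {M N : ℝ}
    (hN : 0 < N)
    (hκ : ∀ w ∈ Icc (-4 : ℝ) 4, HasDerivAt κ (κ' w) w)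
    (hκ' : ∀ w ∈ Icc (-4 : ℝ) 4, HasDerivAt κ' (κ'' w) w) (hκ'' : ContinuousOn κ'' (Icc (-4) 4))
    (h0 : κ (-4) = 0) (h1 : κ 4 = 0) (h0' : κ' (-4) = 0) (h1' : κ' 4 = 0)
    (hM : ∀ w ∈ Icc (-4 : ℝ) 4, ‖κ w‖ ≤ M) (hM' : ∀ w ∈ Icc (-4 : ℝ) 4, ‖κ' w‖ ≤ M)
    (hM'' : ∀ w ∈ Icc (-4 : ℝ) 4, ‖κ'' w‖ ≤ M) :
    ∫ t in band N, ‖oscInt a κ t‖ ^ 2 ≤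
      800 * (4 * M + 16 * (M * B) + 16 * (M * B ^ 2)) ^ 2 / |P| * (3 / (N * |P|)) ^ 4 +
      800 * (4 * (M * B)) ^ 2 / |P| * (3 / (N * |P|)) ^ 2 := by
  have hcκ : ContinuousOn κ (Icc (-4) 4) := fun w hw => (hκ w hw).continuousAt.continuousWithinAt
  have hcκ' : ContinuousOn κ' (Icc (-4) 4) :=
    fun w hw => (hκ' w hw).continuousAt.continuousWithinAt
  have hM0 : 0 ≤ M := (norm_nonneg _).trans (hM 0 (by norm_num))
  have hB0 := h.bound_nonneg
  have hP := abs_pos.2 h.ne_zero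
  have hi := h.continuousOn_inv_slope
  have hb' := h.continuousOn_slope_deriv
  set ρ : ℝ → ℂ := fun w => κ' w / b w with hρ
  set ρ' : ℝ → ℂ := fun w => κ'' w / b w - κ' w * b' w / (b w : ℂ) ^ 2 with hρ'
  set α : ℝ → ℂ := fun w => κ w * b' w / (b w : ℂ) ^ 2 with hα
  have hcρ : ContinuousOn ρ (Icc (-4) 4) := by
    simp only [hρ, div_eq_mul_inv]
    fun_prop
  have hcρ' : ContinuousOn ρ' (Icc (-4) 4) := by
    simp only [hρ', div_eq_mul_inv, ← inv_pow]
    fun_prop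
  have hcα : ContinuousOn α (Icc (-4) 4) := by
    simp only [hα, div_eq_mul_inv, ← inv_pow]
    fun_prop
  have hbα : ∀ w ∈ Icc (-4 : ℝ) 4, ‖α w‖ ≤ 4 * (M * B) := by
    intro w hw
    simp only [hα, div_eq_mul_inv, ← inv_pow, norm_mul, norm_pow]
    calc _ ≤ M * B * 2 ^ 2 := by
          gcongr
          exacts [hM w hw, h.norm_slope_deriv_le hw, h.norm_inv_slope_le hw]
      _ = _ := by ring
  have hdρ : ∀ w ∈ Icc (-4 : ℝ) 4, HasDerivAt ρ (ρ' w) w := by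
    intro w hw
    have hne : (b w : ℂ) ≠ 0 := by exact_mod_cast h.slope_ne_zero hw
    refine ((hκ' w hw).div (h.deriv_slope w).ofReal_comp hne).congr_deriv ?_
    simp only [hρ']
    field_simp
  have hbρ : ∀ w ∈ Icc (-4 : ℝ) 4, ‖ρ w‖ ≤ 2 * M + 4 * (M * B) := by
    intro w hw
    simp only [hρ, div_eq_mul_inv, norm_mul]
    calc _ ≤ M * 2 := by
          gcongr
          exacts [hM' w hw, h.norm_inv_slope_le hw]
      _ ≤ _ := by nlinarith [mul_nonneg hM0 hB0]
  have hbρ' : ∀ w ∈ Icc (-4 : ℝ) 4, ‖ρ' w‖ ≤ 2 * M + 4 * (M * B) := by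
    intro w hw
    simp only [hρ', div_eq_mul_inv, ← inv_pow]
    refine (norm_sub_le _ _).trans ?_
    simp only [norm_mul, norm_pow]
    calc _ ≤ M * 2 + M * B * 2 ^ 2 := by
          gcongr
          exacts [hM'' w hw, h.norm_inv_slope_le hw, hM' w hw, h.norm_slope_deriv_le hw,
            h.norm_inv_slope_le hw]
      _ = _ := by ring
  have hsub : ∀ t, oscInt a (fun w => κ' w / b w - κ w * b' w / (b w : ℂ) ^ 2) t =
      oscInt a ρ t - oscInt a α t := by
    intro t
    simp only [oscInt]
    rw [← integral_sub]
    · simp only [hρ, hα, sub_mul]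
    all_goals
      refine ContinuousOn.integrableOn_compact isCompact_Icc (ContinuousOn.mul (by assumption) ?_)
      have := h.continuous_phase
      fun_prop
  have hiρ := integrableOn_band_norm_sq (continuous_oscInt hcρ h.continuous_phase) N
  have hiα := integrableOn_band_norm_sq (continuous_oscInt hcα h.continuous_phase) N
  have e1 := h.setIntegral_band_le_of_deriv hN hdρ hcρ' (by simp [hρ, h0']) (by simp [hρ, h1'])
    hbρ hbρ'
  have e2 := h.setIntegral_band_le hN hcα hbα
  have e3 : ∫ t in band N, ‖oscInt a κ t‖ ^ 2 ≤ 2 * (3 / (N * |P|)) ^ 2 *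
      (∫ t in band N, ‖oscInt a ρ t‖ ^ 2) + 2 * (3 / (N * |P|)) ^ 2 *
      (∫ t in band N, ‖oscInt a α t‖ ^ 2) := by
    rw [← integral_const_mul, ← integral_const_mul, ← integral_add (hiρ.const_mul _)
      (hiα.const_mul _)]
    refine setIntegral_mono_on
      (integrableOn_band_norm_sq (continuous_oscInt hcκ h.continuous_phase) N)
      ((hiρ.const_mul _).add (hiα.const_mul _)) (measurableSet_band N) fun t ht => ?_
    have hle : ‖oscInt a κ t‖ ≤ 3 / (N * |P|) * (‖oscInt a ρ t‖ + ‖oscInt a α t‖) := by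
      refine h.norm_oscInt_le_of_mul hN ht ?_
      rw [h.oscInt_eq_oscInt_deriv_div hκ hcκ' h0 h1, hsub]
      exact norm_sub_le _ _
    calc ‖oscInt a κ t‖ ^ 2 ≤ (3 / (N * |P|) * (‖oscInt a ρ t‖ + ‖oscInt a α t‖)) ^ 2 := by
          gcongr
      _ = (3 / (N * |P|)) ^ 2 * (‖oscInt a ρ t‖ + ‖oscInt a α t‖) ^ 2 := by ring
      _ ≤ (3 / (N * |P|)) ^ 2 * (2 * (‖oscInt a ρ t‖ ^ 2 + ‖oscInt a α t‖ ^ 2)) := by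
          gcongr
          exact add_sq_le
      _ = _ := by ring
  refine e3.trans ?_
  calc _ ≤ 2 * (3 / (N * |P|)) ^ 2 *
        (400 * (2 * (2 * M + 4 * (M * B)) + 4 * ((2 * M + 4 * (M * B)) * B)) ^ 2 / |P| *
          (3 / (N * |P|)) ^ 2) +
        2 * (3 / (N * |P|)) ^ 2 * (400 * (4 * (M * B)) ^ 2 / |P|) := by gcongr
    _ = _ := by ring

end IsPhase

/-- The integral `∫_{x₁ ≥ e(x₂)} h(x) e^{-i η·x} dx`. -/
def edgeBulk (e : ℝ → ℝ) (h : ℝ × ℝ → ℂ) (η : ℝ × ℝ) : ℂ :=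
  ∫ u in {u : ℝ × ℝ | e u.2 ≤ u.1},
    h u * Complex.exp (-(Complex.I * ((η.1 * u.1 + η.2 * u.2 : ℝ) : ℂ)))

/-- The integral `∫ k(w) e^{-i η·(e(w), w)} dw` along the graph of `e`. -/
def edgeLine (e : ℝ → ℝ) (k : ℝ → ℂ) (η : ℝ × ℝ) : ℂ :=
  ∫ w, k w * Complex.exp (-(Complex.I * ((η.1 * e w + η.2 * w : ℝ) : ℂ)))

lemma measurableSet_region {e : ℝ → ℝ} (he : Continuous e) :
    MeasurableSet {u : ℝ × ℝ | e u.2 ≤ u.1} :=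
  (isClosed_le (by fun_prop) (by fun_prop)).measurableSet

/-- The shear `(v, w) ↦ (v + e(w), w)`. -/
def graphShear {e : ℝ → ℝ} (he : Continuous e) : ℝ × ℝ ≃ₜ ℝ × ℝ where
  toFun u := (u.1 + e u.2, u.2)
  invFun u := (u.1 - e u.2, u.2)
  left_inv u := by simp
  right_inv u := by simp
  continuous_toFun := by fun_prop
  continuous_invFun := by fun_prop

lemma setIntegral_region_eq {e : ℝ → ℝ} (he : Continuous e) {G : ℝ × ℝ → ℂ}
    (hG : Continuous G) (hGc : HasCompactSupport G) :
    ∫ u in {u : ℝ × ℝ | e u.2 ≤ u.1}, G u =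
      ∫ u in Ici (0 : ℝ) ×ˢ (univ : Set ℝ), G (u.1 + e u.2, u.2) := by
  have hS := measurableSet_region he
  have hT : MeasurableSet (Ici (0 : ℝ) ×ˢ (univ : Set ℝ)) := measurableSet_Ici.prod .univ
  have hGi : Integrable G := hG.integrable_of_hasCompactSupport hGc
  have hGi' : Integrable fun u : ℝ × ℝ => G (u.1 + e u.2, u.2) :=
    (by fun_prop : Continuous fun u : ℝ × ℝ => G (u.1 + e u.2, u.2)).integrable_of_hasCompactSupport
      (hGc.comp_homeomorph (graphShear he))
  rw [← integral_indicator hS, ← integral_indicator hT, Measure.volume_eq_prod,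
    integral_prod_symm _ (hGi.indicator hS), integral_prod_symm _ (hGi'.indicator hT)]
  congr 1
  funext w
  rw [← integral_add_right_eq_self _ (e w)]
  congr 1
  funext v
  simp [indicator]

/-- The divergence theorem on the region `x₁ ≥ e(x₂)`. -/
lemma setIntegral_region_fderiv {e e' : ℝ → ℝ} (he : ∀ w, HasDerivAt e (e' w) w)
    (he' : Continuous e') {H : ℝ × ℝ → ℂ} (hH : ContDiff ℝ 1 H) (hHc : HasCompactSupport H)
    (d : ℝ × ℝ) :
    ∫ u in {u : ℝ × ℝ | e u.2 ≤ u.1}, fderiv ℝ H u d =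
      -∫ w, ((d.1 - d.2 * e' w : ℝ) : ℂ) * H (e w, w) := by
  have hec : Continuous e := continuous_iff_continuousAt.2 fun w => (he w).continuousAt
  have hDc : Continuous (fderiv ℝ H) := hH.continuous_fderiv (by norm_num)
  have hD : ∀ c : ℝ × ℝ, HasCompactSupport fun u => fderiv ℝ H u c := fun c =>
    (hHc.fderiv (𝕜 := ℝ)).comp_left (g := fun L : ℝ × ℝ →L[ℝ] ℂ => L c) (by simp)
  rw [setIntegral_region_eq hec (by fun_prop) (hD d)]
  set Dv : ℝ × ℝ → ℂ := fun u => fderiv ℝ H (u.1 + e u.2, u.2) (1, 0) with hDv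
  set Dw : ℝ × ℝ → ℂ := fun u => fderiv ℝ H (u.1 + e u.2, u.2) (e' u.2, 1) with hDw
  have hcv : Continuous Dv := by fun_prop
  have hcw : Continuous Dw := by fun_prop
  have hsv : HasCompactSupport Dv := (hD (1, 0)).comp_homeomorph (graphShear hec)
  have hsw : HasCompactSupport Dw := by
    refine ((hHc.fderiv (𝕜 := ℝ)).comp_homeomorph (graphShear hec)).mono fun u hu => ?_
    simp only [hDw, Function.mem_support] at hu
    simp only [Function.mem_support]
    intro h0
    apply hu
    change fderiv ℝ H (u.1 + e u.2, u.2) = 0 at h0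
    simp [h0]
  have hiv : Integrable fun u : ℝ × ℝ => ((d.1 - d.2 * e' u.2 : ℝ) : ℂ) * Dv u :=
    (by fun_prop : Continuous fun u : ℝ × ℝ =>
      ((d.1 - d.2 * e' u.2 : ℝ) : ℂ) * Dv u).integrable_of_hasCompactSupport hsv.mul_left
  have hiw : Integrable Dw := hcw.integrable_of_hasCompactSupport hsw
  have hsplit : ∀ u : ℝ × ℝ, fderiv ℝ H (u.1 + e u.2, u.2) d =
      ((d.1 - d.2 * e' u.2 : ℝ) : ℂ) * Dv u + (d.2 : ℂ) * Dw u := by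
    intro u
    have : d = (d.1 - d.2 * e' u.2) • ((1 : ℝ), (0 : ℝ)) + d.2 • (e' u.2, (1 : ℝ)) := by
      ext <;> simp
    conv_lhs => rw [this]
    rw [map_add, map_smul, map_smul, Complex.real_smul, Complex.real_smul]
  have hHd : ∀ x, HasFDerivAt H (fderiv ℝ H x) x := fun x =>
    ((hH.differentiable (by norm_num)) x).hasFDerivAt
  simp_rw [hsplit]
  have hm : (volume : Measure (ℝ × ℝ)).restrict (Ici (0 : ℝ) ×ˢ (univ : Set ℝ)) =
      (volume.restrict (Ici (0 : ℝ))).prod volume := by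
    rw [Measure.volume_eq_prod, ← Measure.prod_restrict, Measure.restrict_univ]
  rw [integral_add hiv.integrableOn (hiw.const_mul _).integrableOn, integral_const_mul]
  have hw0 : ∫ u in Ici (0 : ℝ) ×ˢ (univ : Set ℝ), Dw u = 0 := by
    have := hiw.integrableOn (s := Ici (0 : ℝ) ×ˢ (univ : Set ℝ))
    rw [IntegrableOn, hm] at this
    rw [hm, integral_prod _ this]
    have : ∀ v : ℝ, ∫ w, Dw (v, w) = 0 := by
      intro v
      have hd : ∀ w, HasDerivAt (fun w => H (v + e w, w)) (Dw (v, w)) w := fun w =>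
        HasFDerivAt.comp_hasDerivAt (f := fun w => (v + e w, w)) w (hHd (v + e w, w)) (((he w).const_add v).prodMk (hasDerivAt_id w))
      have hcs : Topology.IsClosedEmbedding fun w : ℝ => (v + e w, w) :=
        (graphShear hec).isClosedEmbedding.comp
          (Topology.IsClosedEmbedding.of_continuous_injective_isClosedMap (by fun_prop)
            (Prod.mk_right_injective v) (isClosedMap_prodMk_left v))
      refine integral_eq_zero_of_hasDerivAt_of_integrable hd ?_ ?_
      · exact (by fun_prop : Continuous fun w => Dw (v, w)).integrable_of_hasCompactSupport
          (hsw.comp_isClosedEmbedding (g := fun w : ℝ => (v, w))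
            (Topology.IsClosedEmbedding.of_continuous_injective_isClosedMap (by fun_prop)
            (Prod.mk_right_injective v) (isClosedMap_prodMk_left v)))
      · have := hH.continuous
        exact (by fun_prop : Continuous fun w => H (v + e w, w)).integrable_of_hasCompactSupport
          (hHc.comp_isClosedEmbedding hcs)
    simp [this]
  have hv0 : ∫ u in Ici (0 : ℝ) ×ˢ (univ : Set ℝ), ((d.1 - d.2 * e' u.2 : ℝ) : ℂ) * Dv u =
      -∫ w, ((d.1 - d.2 * e' w : ℝ) : ℂ) * H (e w, w) := by
    have := hiv.integrableOn (s := Ici (0 : ℝ) ×ˢ (univ : Set ℝ))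
    rw [IntegrableOn, hm] at this
    rw [hm, integral_prod_symm _ this, ← integral_neg]
    congr 1
    funext w
    refine (integral_const_mul (((d.1 - d.2 * e' w : ℝ) : ℂ)) fun v => Dv (v, w)).trans ?_
    rw [integral_Ici_eq_integral_Ioi]
    have hd : ∀ v, HasDerivAt (fun v => H (v + e w, w)) (Dv (v, w)) v := fun v =>
      HasFDerivAt.comp_hasDerivAt (f := fun v => (v + e w, w)) v (hHd (v + e w, w))
        (((hasDerivAt_id v).add_const (e w)).prodMk (hasDerivAt_const v w))
    have hcl : Topology.IsClosedEmbedding fun v : ℝ => (v + e w, w) :=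
        (graphShear hec).isClosedEmbedding.comp
          (Topology.IsClosedEmbedding.of_continuous_injective_isClosedMap (f := fun v : ℝ => (v, w))
            (by fun_prop) (Prod.mk_left_injective w) (isClosedMap_prodMk_right w))
    have := HasCompactSupport.integral_Ioi_deriv_eq (f := fun v => H (v + e w, w))
      (hH.comp (by fun_prop)) (hHc.comp_isClosedEmbedding hcl) 0
    simp only [(hd _).deriv, zero_add] at this
    rw [this, mul_neg]
  rw [hv0, hw0, mul_zero, add_zero]

/-- Integration by parts for Fourier integrals over the region `x₁ ≥ e(x₂)`. -/
lemma mul_edgeBulk {e e' : ℝ → ℝ} (he : ∀ w, HasDerivAt e (e' w) w)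
    (he' : Continuous e') {h : ℝ × ℝ → ℂ} (hh : ContDiff ℝ 1 h) (hc : HasCompactSupport h)
    (d η : ℝ × ℝ) :
    Complex.I * ((d.1 * η.1 + d.2 * η.2 : ℝ) : ℂ) * edgeBulk e h η =
      edgeLine e (fun w => ((d.1 - d.2 * e' w : ℝ) : ℂ) * h (e w, w)) η +
        edgeBulk e (fun u => fderiv ℝ h u d) η := by
  have hec : Continuous e := continuous_iff_continuousAt.2 fun w => (he w).continuousAt
  set X : ℝ × ℝ → ℂ := fun u =>
    Complex.exp (-(Complex.I * ((η.1 * u.1 + η.2 * u.2 : ℝ) : ℂ))) with hX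
  have hXs : ContDiff ℝ 1 X := by
    simp only [hX]
    refine ContDiff.cexp (ContDiff.neg (contDiff_const.mul ?_))
    exact Complex.ofRealCLM.contDiff.comp
      ((contDiff_const.mul contDiff_fst).add (contDiff_const.mul contDiff_snd))
  have hXd : ∀ u, fderiv ℝ X u d = -(Complex.I * ((d.1 * η.1 + d.2 * η.2 : ℝ) : ℂ)) * X u := by
    intro u
    have h1 : HasFDerivAt X (fderiv ℝ X u) u :=
      ((hXs.differentiable (by norm_num)) u).hasFDerivAt
    have hl : HasDerivAt (fun s : ℝ => u + s • d) d 0 := by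
      simpa using ((hasDerivAt_id (0 : ℝ)).smul_const d).const_add u
    have h2 : HasDerivAt (fun s : ℝ => X (u + s • d)) (fderiv ℝ X u d) 0 := by
      have h1' : HasFDerivAt X (fderiv ℝ X u) (u + (0 : ℝ) • d) := by
        rwa [zero_smul, add_zero]
      exact h1'.comp_hasDerivAt (f := fun s : ℝ => u + s • d) (0 : ℝ) hl
    have h3 : HasDerivAt (fun s : ℝ => X (u + s • d))
        (X u * -(Complex.I * ((η.1 * d.1 + η.2 * d.2 : ℝ) : ℂ))) 0 := by
      have : HasDerivAt (fun s : ℝ => η.1 * (u.1 + s * d.1) + η.2 * (u.2 + s * d.2))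
          (η.1 * d.1 + η.2 * d.2) 0 := by
        refine HasDerivAt.congr_deriv (((((hasDerivAt_id (0 : ℝ)).mul_const d.1).const_add u.1).const_mul η.1).add
          ((((hasDerivAt_id (0 : ℝ)).mul_const d.2).const_add u.2).const_mul η.2)) ?_
        simp
      have := (this.ofReal_comp.const_mul Complex.I).neg.cexp
      simpa [hX] using this
    rw [h2.unique h3]
    push_cast
    ring
  have hH := setIntegral_region_fderiv he he' (hh.mul hXs) hc.mul_right d
  have hcD : HasCompactSupport fun u => fderiv ℝ h u d :=
    (hc.fderiv (𝕜 := ℝ)).comp_left (g := fun L : ℝ × ℝ →L[ℝ] ℂ => L d) (by simp)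
  have hDc : Continuous (fderiv ℝ h) := hh.continuous_fderiv (by norm_num)
  have hcX := hXs.continuous
  have hch := hh.continuous
  have hi1 : Integrable fun u => fderiv ℝ h u d * X u :=
    (by fun_prop : Continuous fun u => fderiv ℝ h u d * X u).integrable_of_hasCompactSupport
      hcD.mul_right
  have hi2 : Integrable fun u => h u * X u :=
    (by fun_prop : Continuous fun u => h u * X u).integrable_of_hasCompactSupport hc.mul_right
  have hfd : ∀ u, fderiv ℝ (fun u => h u * X u) u d =
      fderiv ℝ h u d * X u - Complex.I * ((d.1 * η.1 + d.2 * η.2 : ℝ) : ℂ) * (h u * X u) := by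
    intro u
    rw [fderiv_fun_mul ((hh.differentiable (by norm_num)) u) ((hXs.differentiable (by norm_num)) u)]
    simp only [add_apply, smul_apply, smul_eq_mul, hXd]
    ring
  have hH' : ∫ u in {u : ℝ × ℝ | e u.2 ≤ u.1}, fderiv ℝ (fun u => h u * X u) u d =
      -∫ w, ((d.1 - d.2 * e' w : ℝ) : ℂ) * (h (e w, w) * X (e w, w)) := hH
  simp_rw [hfd] at hH'
  rw [integral_sub hi1.integrableOn (hi2.const_mul _).integrableOn, integral_const_mul] at hH'
  have e1 : edgeBulk e h η = ∫ u in {u : ℝ × ℝ | e u.2 ≤ u.1}, h u * X u := rfl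
  have e2 : edgeBulk e (fun u => fderiv ℝ h u d) η =
    ∫ u in {u : ℝ × ℝ | e u.2 ≤ u.1}, fderiv ℝ h u d * X u := rfl
  have e3 : edgeLine e (fun w => ((d.1 - d.2 * e' w : ℝ) : ℂ) * h (e w, w)) η =
      ∫ w, ((d.1 - d.2 * e' w : ℝ) : ℂ) * (h (e w, w) * X (e w, w)) := by
    simp only [edgeLine, hX, mul_assoc]
  rw [e1, e2, e3]
  linear_combination -hH'

/-- A smooth cutoff function supported in `[-π, π]²`. -/
structure IsCutoff (ψ : ℝ × ℝ → ℝ) : Prop where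
  smooth : ContDiff ℝ (⊤ : ℕ∞) ψ
  supp : tsupport ψ ⊆ Icc (-π) π ×ˢ Icc (-π) π

/-- Directional derivative. -/
def dirDeriv (c : ℝ × ℝ) (h : ℝ × ℝ → ℝ) : ℝ × ℝ → ℝ := fun u => fderiv ℝ h u c

/-- The rescaled boundary curve `w ↦ N E(w / N)`. -/
def scaledCurve (E : ℝ → ℝ) (N : ℝ) : ℝ → ℝ := fun w => N * E (N⁻¹ * w)

/-- The Fourier integral of `g(u / N) ψ(u)` over the rescaled region. -/
def bulkTerm (E : ℝ → ℝ) (g ψ : ℝ × ℝ → ℝ) (N : ℝ) : ℝ × ℝ → ℂ :=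
  edgeBulk (scaledCurve E N) fun u => ((g (N⁻¹ • u) * ψ u : ℝ) : ℂ)

/-- The boundary contribution of an integration by parts in direction `p`. -/
def lineTerm (E : ℝ → ℝ) (g ψ : ℝ × ℝ → ℝ) (N : ℝ) (p : ℝ × ℝ) : ℝ × ℝ → ℂ :=
  edgeLine (scaledCurve E N) fun w => (((p.1 - p.2 * deriv E (N⁻¹ * w)) *
    (g (E (N⁻¹ * w), N⁻¹ * w) * ψ (scaledCurve E N w, w)) : ℝ) : ℂ)

lemma dirDeriv_eq (c : ℝ × ℝ) (h : ℝ × ℝ → ℝ) (u : ℝ × ℝ) :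
    dirDeriv c h u = c.1 * dirDeriv (1, 0) h u + c.2 * dirDeriv (0, 1) h u := by
  have : c = c.1 • ((1 : ℝ), (0 : ℝ)) + c.2 • ((0 : ℝ), (1 : ℝ)) := by ext <;> simp
  simp only [dirDeriv]
  conv_lhs => rw [this]
  rw [map_add, map_smul, map_smul, smul_eq_mul, smul_eq_mul]

lemma contDiff_dirDeriv {n : ℕ} {h : ℝ × ℝ → ℝ} (hh : ContDiff ℝ (n + 1 : ℕ) h) (c : ℝ × ℝ) :
    ContDiff ℝ n (dirDeriv c h) :=
  (hh.fderiv_right (m := n) (by norm_cast)).clm_apply contDiff_const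

namespace IsCutoff

variable {ψ : ℝ × ℝ → ℝ}

lemma hasCompactSupport (hψ : IsCutoff ψ) : HasCompactSupport ψ :=
  (isCompact_Icc.prod isCompact_Icc).of_isClosed_subset (isClosed_tsupport ψ) hψ.supp

lemma dirDeriv (hψ : IsCutoff ψ) (c : ℝ × ℝ) : IsCutoff (dirDeriv c ψ) where
  smooth := (hψ.smooth.fderiv_right (m := (⊤ : ℕ∞)) (by norm_cast)).clm_apply contDiff_const
  supp := by
    refine subset_trans (closure_minimal (fun u hu => ?_) (isClosed_tsupport ψ)) hψ.supp
    by_contra h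
    exact hu (by simp [_root_.dirDeriv, fderiv_of_notMem_tsupport ℝ h])

lemma eq_zero (hψ : IsCutoff ψ) {u : ℝ × ℝ} (hu : u ∉ Icc (-π) π ×ˢ Icc (-π) π) : ψ u = 0 :=
  image_eq_zero_of_notMem_tsupport fun h => hu (hψ.supp h)

lemma eq_zero_of_lt (hψ : IsCutoff ψ) {v w : ℝ} (hw : π < |w|) : ψ (v, w) = 0 :=
  hψ.eq_zero fun h => absurd (abs_le.2 h.2) (not_le.2 hw)

lemma bounded (hψ : IsCutoff ψ) : ∃ C, 0 ≤ C ∧ ∀ u, |ψ u| ≤ C := by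
  obtain ⟨C, hC⟩ := hψ.hasCompactSupport.exists_bound_of_continuous hψ.smooth.continuous
  exact ⟨C, (norm_nonneg _).trans (hC 0), hC⟩

end IsCutoff

section

variable {E : ℝ → ℝ} {g ψ : ℝ × ℝ → ℝ}

lemma continuous_scaledCurve (hE : Continuous E) (N : ℝ) : Continuous (scaledCurve E N) := by
  unfold scaledCurve; fun_prop

lemma hasDerivAt_scaledCurve (hE : Differentiable ℝ E) {N : ℝ} (hN : N ≠ 0) (w : ℝ) :
    HasDerivAt (scaledCurve E N) (deriv E (N⁻¹ * w)) w := by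
  have := (((hE (N⁻¹ * w)).hasDerivAt.comp w ((hasDerivAt_id w).const_mul N⁻¹))).const_mul N
  refine this.congr_deriv ?_
  field_simp

lemma continuous_edgeBulk {e : ℝ → ℝ} {h : ℝ × ℝ → ℂ} (hh : Continuous h)
    (hc : HasCompactSupport h) : Continuous (edgeBulk e h) := by
  have hi : Integrable h := hh.integrable_of_hasCompactSupport hc
  refine continuous_of_dominated (bound := fun u => ‖h u‖) (fun η => ?_) (fun η => ?_) ?_ ?_
  · exact (by fun_prop : Continuous _).aestronglyMeasurable
  · refine Filter.Eventually.of_forall fun u => ?_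
    rw [norm_mul, norm_exp_neg_I_mul, mul_one]
  · exact hi.norm.integrableOn
  · refine Filter.Eventually.of_forall fun w => ?_
    fun_prop

lemma continuous_edgeLine {e : ℝ → ℝ} {k : ℝ → ℂ} (he : Continuous e) (hk : Continuous k)
    (hc : HasCompactSupport k) : Continuous (edgeLine e k) := by
  have hi : Integrable k := hk.integrable_of_hasCompactSupport hc
  refine continuous_of_dominated (bound := fun u => ‖k u‖) (fun η => ?_) (fun η => ?_) ?_ ?_
  · exact (by fun_prop : Continuous _).aestronglyMeasurable
  · refine Filter.Eventually.of_forall fun u => ?_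
    rw [norm_mul, norm_exp_neg_I_mul, mul_one]
  · exact hi.norm
  · refine Filter.Eventually.of_forall fun w => ?_
    fun_prop

lemma hasCompactSupport_bulk (hψ : IsCutoff ψ) (N : ℝ) :
    HasCompactSupport fun u => ((g (N⁻¹ • u) * ψ u : ℝ) : ℂ) :=
  (hψ.hasCompactSupport.mul_left (f := fun u => g (N⁻¹ • u))).comp_left
    (g := ((↑) : ℝ → ℂ)) (by simp)

lemma continuous_bulkTerm (hg : Continuous g) (hψ : IsCutoff ψ) (N : ℝ) :
    Continuous (bulkTerm E g ψ N) := by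
  have := hψ.smooth.continuous
  exact continuous_edgeBulk (by fun_prop) (hasCompactSupport_bulk hψ N)

lemma continuous_lineTerm (hE : ContDiff ℝ 1 E) (hg : Continuous g) (hψ : IsCutoff ψ) (N : ℝ)
    (p : ℝ × ℝ) : Continuous (lineTerm E g ψ N p) := by
  have := hψ.smooth.continuous
  have h1 := hE.continuous
  have h2 := hE.continuous_deriv le_rfl
  have h3 := continuous_scaledCurve h1 N
  refine continuous_edgeLine h3 (by fun_prop) ?_
  refine HasCompactSupport.intro (isCompact_Icc (a := -π) (b := π)) fun w hw => ?_
  rw [hψ.eq_zero_of_lt]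
  · simp
  · exact not_le.1 fun h => hw (abs_le.1 h)

lemma bulkTerm_integrable (hg : Continuous g) (hψ : IsCutoff ψ) (N : ℝ) (η : ℝ × ℝ) :
    Integrable fun u : ℝ × ℝ => ((g (N⁻¹ • u) * ψ u : ℝ) : ℂ) *
      Complex.exp (-(Complex.I * ((η.1 * u.1 + η.2 * u.2 : ℝ) : ℂ))) := by
  have := hψ.smooth.continuous
  exact (by fun_prop : Continuous fun u : ℝ × ℝ => ((g (N⁻¹ • u) * ψ u : ℝ) : ℂ) *
      Complex.exp (-(Complex.I * ((η.1 * u.1 + η.2 * u.2 : ℝ) : ℂ)))).integrable_of_hasCompactSupport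
    (hasCompactSupport_bulk hψ N).mul_right

/-- Integration by parts in direction `p` for the rescaled Fourier integrals. -/
lemma mul_bulkTerm (hE : ContDiff ℝ 1 E) (hg : ContDiff ℝ 1 g) (hψ : IsCutoff ψ) {N : ℝ}
    (hN : N ≠ 0) (p η : ℝ × ℝ) :
    Complex.I * ((p.1 * η.1 + p.2 * η.2 : ℝ) : ℂ) * bulkTerm E g ψ N η =
      lineTerm E g ψ N p η +
      (N : ℂ)⁻¹ * (p.1 * bulkTerm E (dirDeriv (1, 0) g) ψ N η +
        p.2 * bulkTerm E (dirDeriv (0, 1) g) ψ N η) +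
      (p.1 * bulkTerm E g (dirDeriv (1, 0) ψ) N η +
        p.2 * bulkTerm E g (dirDeriv (0, 1) ψ) N η) := by
  have hψ1 : ContDiff ℝ 1 ψ := hψ.smooth.of_le (by norm_cast)
  have hh : ContDiff ℝ 1 fun u : ℝ × ℝ => g (N⁻¹ • u) * ψ u :=
    (hg.comp (contDiff_const_smul _)).mul hψ1
  have key := mul_edgeBulk (hasDerivAt_scaledCurve (hE.differentiable (by norm_num)) hN)
    (by have := hE.continuous_deriv le_rfl; fun_prop)
    (Complex.ofRealCLM.contDiff.comp hh) (hasCompactSupport_bulk (g := g) hψ N) p η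
  have hfd : ∀ u : ℝ × ℝ, fderiv ℝ (fun u : ℝ × ℝ => ((g (N⁻¹ • u) * ψ u : ℝ) : ℂ)) u p =
      ((N⁻¹ * (dirDeriv p g (N⁻¹ • u) * ψ u) + g (N⁻¹ • u) * dirDeriv p ψ u : ℝ) : ℂ) := by
    intro u
    have h1 : HasFDerivAt (fun u : ℝ × ℝ => N⁻¹ • u) (N⁻¹ • ContinuousLinearMap.id ℝ (ℝ × ℝ)) u :=
      (hasFDerivAt_id u).const_smul N⁻¹
    have h2 : HasFDerivAt g (fderiv ℝ g (N⁻¹ • u)) (N⁻¹ • u) :=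
      (hg.differentiable (by norm_num) _).hasFDerivAt
    have h3 : HasFDerivAt ψ (fderiv ℝ ψ u) u := (hψ1.differentiable (by norm_num) _).hasFDerivAt
    have h4 := Complex.ofRealCLM.hasFDerivAt.comp u ((h2.comp u h1).mul h3)
    have h5 : fderiv ℝ (fun u : ℝ × ℝ => ((g (N⁻¹ • u) * ψ u : ℝ) : ℂ)) u = _ := h4.fderiv
    rw [h5]
    simp [dirDeriv]
    ring
  have e1 : bulkTerm E g ψ N η = edgeBulk (scaledCurve E N)
    (Complex.ofRealCLM ∘ fun u : ℝ × ℝ => g (N⁻¹ • u) * ψ u) η := rfl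
  rw [e1, key, add_assoc]
  congr 1
  · simp only [lineTerm]
    congr 1
    funext w
    have : N⁻¹ • (scaledCurve E N w, w) = (E (N⁻¹ * w), N⁻¹ * w) := by
      simp only [scaledCurve, Prod.smul_mk, smul_eq_mul]
      rw [inv_mul_cancel_left₀ hN]
    simp only [Function.comp, this, Complex.ofRealCLM_apply]
    push_cast
    ring
  · have hgc := hg.continuous
    have hc : ∀ c, Continuous (dirDeriv c g) := fun c =>
      (contDiff_dirDeriv (n := 0) hg c).continuous
    have i1 := (bulkTerm_integrable (hc (1, 0)) hψ N η).integrableOn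
      (s := {u : ℝ × ℝ | scaledCurve E N u.2 ≤ u.1})
    have i2 := (bulkTerm_integrable (hc (0, 1)) hψ N η).integrableOn
      (s := {u : ℝ × ℝ | scaledCurve E N u.2 ≤ u.1})
    have i3 := (bulkTerm_integrable hgc (hψ.dirDeriv (1, 0)) N η).integrableOn
      (s := {u : ℝ × ℝ | scaledCurve E N u.2 ≤ u.1})
    have i4 := (bulkTerm_integrable hgc (hψ.dirDeriv (0, 1)) N η).integrableOn
      (s := {u : ℝ × ℝ | scaledCurve E N u.2 ≤ u.1})
    have j1 := (i1.const_mul (p.1 : ℂ)).add (i2.const_mul (p.2 : ℂ))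
    have j2 := (i3.const_mul (p.1 : ℂ)).add (i4.const_mul (p.2 : ℂ))
    simp only [bulkTerm, edgeBulk]
    rw [← integral_const_mul, ← integral_const_mul, ← integral_const_mul, ← integral_const_mul,
      ← integral_add (i1.const_mul _) (i2.const_mul _),
      ← integral_add (i3.const_mul _) (i4.const_mul _), ← integral_const_mul]
    refine Eq.trans ?_ (integral_add (j1.const_mul _) j2)
    congr 1
    funext u
    change fderiv ℝ (fun u : ℝ × ℝ => ((g (N⁻¹ • u) * ψ u : ℝ) : ℂ)) u p * _ = _
    rw [hfd, dirDeriv_eq p g, dirDeriv_eq p ψ]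
    push_cast
    ring

end

/-- The point `t p + ν q`. -/
def linePoint (p q : ℝ × ℝ) (ν t : ℝ) : ℝ × ℝ := (t * p.1 + ν * q.1, t * p.2 + ν * q.2)

/-- The admissible scales and directions. -/
structure IsAdmissible (N : ℝ) (p q : ℝ × ℝ) (ν : ℝ) : Prop where
  le_scale : 6 ≤ N
  one_le : 1 ≤ p.1 ^ 2 + p.2 ^ 2
  le_two : p.1 ^ 2 + p.2 ^ 2 ≤ 2
  le_one : q.1 ^ 2 + q.2 ^ 2 ≤ 1
  abs_le : |ν| ≤ 1

/-- Uniform `L²` bounds along lines, of relative size `ε(N, N|p₂|)`, when `N|p₂| ≥ K`. -/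
structure BandBound (K : ℝ) (X : ℝ → ℝ × ℝ → ℝ × ℝ → ℂ) (ε : ℝ → ℝ → ℝ) : Prop where
  cont : ∀ N p, Continuous (X N p)
  bound : ∃ C ≥ 0, ∀ N p q ν, IsAdmissible N p q ν → K ≤ N * |p.2| →
    ∫ t in band N, ‖X N p (linePoint p q ν t)‖ ^ 2 ≤ C * ε N (N * |p.2|) ^ 2 / |p.2|

lemma continuous_linePoint (p q : ℝ × ℝ) (ν : ℝ) : Continuous (linePoint p q ν) := by
  unfold linePoint; fun_prop

namespace IsAdmissible

variable {N : ℝ} {p q : ℝ × ℝ} {ν : ℝ}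

lemma pos (h : IsAdmissible N p q ν) : 0 < N := by linarith [h.le_scale]

lemma abs_fst_le (h : IsAdmissible N p q ν) : |p.1| ≤ 2 := by
  refine abs_le_of_sq_le_sq ?_ (by norm_num)
  nlinarith [h.le_two, sq_nonneg p.2]

lemma abs_snd_le (h : IsAdmissible N p q ν) : |p.2| ≤ 2 := by
  refine abs_le_of_sq_le_sq ?_ (by norm_num)
  nlinarith [h.le_two, sq_nonneg p.1]

lemma le_abs_dot (h : IsAdmissible N p q ν) {t : ℝ} (ht : t ∈ band N) :
    N / 12 ≤ |p.1 * (linePoint p q ν t).1 + p.2 * (linePoint p q ν t).2| := by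
  have e : p.1 * (linePoint p q ν t).1 + p.2 * (linePoint p q ν t).2 =
      t * (p.1 ^ 2 + p.2 ^ 2) + ν * (p.1 * q.1 + p.2 * q.2) := by
    simp only [linePoint]; ring
  have h1 : N / 3 ≤ |t * (p.1 ^ 2 + p.2 ^ 2)| := by
    rw [abs_mul, abs_of_nonneg (by positivity : 0 ≤ p.1 ^ 2 + p.2 ^ 2)]
    nlinarith [ht.1, h.one_le, abs_nonneg t]
  have h2 : |ν * (p.1 * q.1 + p.2 * q.2)| ≤ 3 / 2 := by
    rw [abs_mul]
    have : |p.1 * q.1 + p.2 * q.2| ≤ 3 / 2 := by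
      rw [_root_.abs_le]
      constructor <;> nlinarith [h.le_two, h.le_one, sq_nonneg (p.1 - q.1), sq_nonneg (p.2 - q.2),
        sq_nonneg (p.1 + q.1), sq_nonneg (p.2 + q.2)]
    nlinarith [h.abs_le, abs_nonneg ν, abs_nonneg (p.1 * q.1 + p.2 * q.2)]
  rw [e]
  have h3 := abs_sub_abs_le_abs_sub (t * (p.1 ^ 2 + p.2 ^ 2)) (-(ν * (p.1 * q.1 + p.2 * q.2)))
  rw [sub_neg_eq_add, abs_neg] at h3
  linarith [h.le_scale]

end IsAdmissible

lemma integrableOn_band_comp_linePoint {X : ℝ × ℝ → ℂ} (hX : Continuous X) (p q : ℝ × ℝ)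
    (ν N : ℝ) : IntegrableOn (fun t => ‖X (linePoint p q ν t)‖ ^ 2) (band N) :=
  integrableOn_band_norm_sq (hX.comp (continuous_linePoint p q ν)) N

lemma norm_sq_add_five_le (a b c d e : ℂ) :
    ‖a + b + c + d + e‖ ^ 2 ≤ 5 * (‖a‖ ^ 2 + ‖b‖ ^ 2 + ‖c‖ ^ 2 + ‖d‖ ^ 2 + ‖e‖ ^ 2) := by
  have h : ‖a + b + c + d + e‖ ≤ ‖a‖ + ‖b‖ + ‖c‖ + ‖d‖ + ‖e‖ :=
    (norm_add_le _ _).trans (by gcongr; exact norm_add₄_le)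
  refine (pow_le_pow_left₀ (norm_nonneg _) h 2).trans ?_
  nlinarith [sq_nonneg (‖a‖ - ‖b‖), sq_nonneg (‖a‖ - ‖c‖), sq_nonneg (‖a‖ - ‖d‖),
    sq_nonneg (‖a‖ - ‖e‖), sq_nonneg (‖b‖ - ‖c‖), sq_nonneg (‖b‖ - ‖d‖), sq_nonneg (‖b‖ - ‖e‖),
    sq_nonneg (‖c‖ - ‖d‖), sq_nonneg (‖c‖ - ‖e‖), sq_nonneg (‖d‖ - ‖e‖)]

section

variable {E : ℝ → ℝ} {g ψ : ℝ × ℝ → ℝ}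

/-- Pointwise form of the integration by parts estimate. -/
lemma norm_sq_bulkTerm_le (hE : ContDiff ℝ 1 E) (hg : ContDiff ℝ 1 g) (hψ : IsCutoff ψ)
    {N ν t : ℝ} {p q : ℝ × ℝ} (h : IsAdmissible N p q ν) (ht : t ∈ band N) :
    ‖bulkTerm E g ψ N (linePoint p q ν t)‖ ^ 2 ≤ 2880 / N ^ 2 *
      (‖lineTerm E g ψ N p (linePoint p q ν t)‖ ^ 2 +
        1 / N ^ 2 * ‖bulkTerm E (dirDeriv (1, 0) g) ψ N (linePoint p q ν t)‖ ^ 2 +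
        1 / N ^ 2 * ‖bulkTerm E (dirDeriv (0, 1) g) ψ N (linePoint p q ν t)‖ ^ 2 +
        ‖bulkTerm E g (dirDeriv (1, 0) ψ) N (linePoint p q ν t)‖ ^ 2 +
        ‖bulkTerm E g (dirDeriv (0, 1) ψ) N (linePoint p q ν t)‖ ^ 2) := by
  have hN := h.pos
  set η := linePoint p q ν t with hη
  have key := mul_bulkTerm hE hg hψ hN.ne' p η
  have hdot : (N / 12) ^ 2 * ‖bulkTerm E g ψ N η‖ ^ 2 ≤
      ‖Complex.I * ((p.1 * η.1 + p.2 * η.2 : ℝ) : ℂ) * bulkTerm E g ψ N η‖ ^ 2 := by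
    rw [← mul_pow, norm_mul, norm_mul, Complex.norm_I, one_mul, Complex.norm_real,
      Real.norm_eq_abs]
    gcongr
    exact h.le_abs_dot ht
  have hp1 : p.1 ^ 2 ≤ 2 := by nlinarith [h.le_two, sq_nonneg p.2]
  have hp2 : p.2 ^ 2 ≤ 2 := by nlinarith [h.le_two, sq_nonneg p.1]
  rw [key, mul_add, ← add_assoc, ← add_assoc] at hdot
  replace hdot := hdot.trans (norm_sq_add_five_le _ _ _ _ _)
  simp only [norm_mul, mul_pow, norm_inv, Complex.norm_real, Real.norm_eq_abs, sq_abs, inv_pow]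
    at hdot
  rw [div_mul_eq_mul_div, le_div_iff₀ (by positivity)]
  have : ‖bulkTerm E g ψ N η‖ ^ 2 * N ^ 2 = 144 * ((N / 12) ^ 2 * ‖bulkTerm E g ψ N η‖ ^ 2) := by
    ring
  rw [this]
  refine (mul_le_mul_of_nonneg_left hdot (by norm_num)).trans ?_
  have hle : ∀ {x y : ℝ}, x ≤ 2 → 0 ≤ y → x * y ≤ 2 * y := fun hx hy =>
    mul_le_mul_of_nonneg_right hx hy
  have hN2 : 0 ≤ (N ^ 2)⁻¹ := by positivity
  have a1 := mul_le_mul_of_nonneg_left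
    (hle hp1 (sq_nonneg ‖bulkTerm E (dirDeriv (1, 0) g) ψ N η‖)) hN2
  have a2 := mul_le_mul_of_nonneg_left
    (hle hp2 (sq_nonneg ‖bulkTerm E (dirDeriv (0, 1) g) ψ N η‖)) hN2
  have a3 := hle hp1 (sq_nonneg ‖bulkTerm E g (dirDeriv (1, 0) ψ) N η‖)
  have a4 := hle hp2 (sq_nonneg ‖bulkTerm E g (dirDeriv (0, 1) ψ) N η‖)
  rw [one_div]
  nlinarith [sq_nonneg ‖lineTerm E g ψ N p η‖]

/-- One integration by parts improves `L²` bounds. -/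
lemma BandBound.of_step {K c : ℝ} {εL ε ε₂ ε' : ℝ → ℝ → ℝ} (hE : ContDiff ℝ 1 E)
    (hg : ContDiff ℝ 1 g) (hψ : IsCutoff ψ) (hL : BandBound K (lineTerm E g ψ) εL)
    (h2 : ∀ d, BandBound K (fun N _ => bulkTerm E (dirDeriv d g) ψ N) ε₂)
    (h1 : ∀ d, BandBound K (fun N _ => bulkTerm E g (dirDeriv d ψ) N) ε) (hc : 0 ≤ c)
    (hε : ∀ N σ, 6 ≤ N → K ≤ σ → 0 ≤ σ → σ ≤ 2 * N →
      εL N σ ^ 2 + ε₂ N σ ^ 2 / N ^ 2 + ε N σ ^ 2 ≤ c * (N ^ 2 * ε' N σ ^ 2)) :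
    BandBound K (fun N _ => bulkTerm E g ψ N) ε' := by
  refine ⟨fun N _ => continuous_bulkTerm hg.continuous hψ N, ?_⟩
  obtain ⟨C0, hC0, b0⟩ := hL.bound
  obtain ⟨C1, hC1, b1⟩ := (h2 (1, 0)).bound
  obtain ⟨C2, hC2, b2⟩ := (h2 (0, 1)).bound
  obtain ⟨C3, hC3, b3⟩ := (h1 (1, 0)).bound
  obtain ⟨C4, hC4, b4⟩ := (h1 (0, 1)).bound
  refine ⟨2880 * ((C0 + C1 + C2 + C3 + C4) * c), by positivity, fun N p q ν h hK => ?_⟩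
  have hN := h.pos
  specialize b0 N p q ν h hK
  specialize b1 N p q ν h hK
  specialize b2 N p q ν h hK
  specialize b3 N p q ν h hK
  specialize b4 N p q ν h hK
  have i0 := integrableOn_band_comp_linePoint (hL.cont N p) p q ν N
  have i1 := (integrableOn_band_comp_linePoint ((h2 (1, 0)).cont N p) p q ν N).const_mul (1 / N ^ 2)
  have i2 := (integrableOn_band_comp_linePoint ((h2 (0, 1)).cont N p) p q ν N).const_mul (1 / N ^ 2)
  have i3 := integrableOn_band_comp_linePoint ((h1 (1, 0)).cont N p) p q ν N
  have i4 := integrableOn_band_comp_linePoint ((h1 (0, 1)).cont N p) p q ν N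
  have i := integrableOn_band_comp_linePoint (continuous_bulkTerm (E := E) hg.continuous hψ N) p q ν N
  have hintg := setIntegral_mono_on i (((((i0.add i1).add i2).add i3).add i4).const_mul (2880 / N ^ 2))
    (measurableSet_band N) fun t ht => norm_sq_bulkTerm_le hE hg hψ h ht
  refine hintg.trans ?_
  have hsum := integral_const_mul (μ := volume.restrict (band N)) (2880 / N ^ 2)
    (fun t => ‖lineTerm E g ψ N p (linePoint p q ν t)‖ ^ 2 +
        1 / N ^ 2 * ‖bulkTerm E (dirDeriv (1, 0) g) ψ N (linePoint p q ν t)‖ ^ 2 +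
        1 / N ^ 2 * ‖bulkTerm E (dirDeriv (0, 1) g) ψ N (linePoint p q ν t)‖ ^ 2 +
        ‖bulkTerm E g (dirDeriv (1, 0) ψ) N (linePoint p q ν t)‖ ^ 2 +
        ‖bulkTerm E g (dirDeriv (0, 1) ψ) N (linePoint p q ν t)‖ ^ 2)
  have e4 := integral_add (((i0.add i1).add i2).add i3) i4
  have e3 := integral_add ((i0.add i1).add i2) i3
  have e2 := integral_add (i0.add i1) i2
  have e1 := integral_add i0 i1
  simp only [Pi.add_apply] at e4 e3 e2 e1
  rw [integral_const_mul] at e2 e1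
  refine hsum.le.trans ?_
  rw [e4, e3, e2, e1]
  set σ := N * |p.2| with hσ
  have hσ2 : σ ≤ 2 * N := by nlinarith [h.abs_snd_le]
  have hε' := hε N σ h.le_scale hK (by positivity) hσ2
  set P := |p.2|
  have hP : 0 ≤ P := abs_nonneg _
  set x := εL N σ ^ 2
  set y := ε₂ N σ ^ 2
  set z := ε N σ ^ 2
  have hx : 0 ≤ x := sq_nonneg _
  have hy : 0 ≤ y := sq_nonneg _
  have hz : 0 ≤ z := sq_nonneg _
  set S := C0 + C1 + C2 + C3 + C4 with hS
  calc _ ≤ 2880 / N ^ 2 * (C0 * x / P + 1 / N ^ 2 * (C1 * y / P) + 1 / N ^ 2 * (C2 * y / P) +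
        C3 * z / P + C4 * z / P) := by gcongr
    _ = 2880 / N ^ 2 * ((C0 * x + (C1 + C2) * (y / N ^ 2) + (C3 + C4) * z) / P) := by ring
    _ ≤ 2880 / N ^ 2 * ((S * x + S * (y / N ^ 2) + S * z) / P) := by
        have : C0 ≤ S := by linarith
        have : C1 + C2 ≤ S := by linarith
        have : C3 + C4 ≤ S := by linarith
        gcongr
    _ = 2880 / N ^ 2 * (S * (x + y / N ^ 2 + z) / P) := by ring
    _ ≤ 2880 / N ^ 2 * (S * (c * (N ^ 2 * ε' N σ ^ 2)) / P) := by gcongr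
    _ = _ := by field_simp

lemma setIntegral_band_const_le {N C : ℝ} (hN : 0 ≤ N) (hC : 0 ≤ C) {X : ℝ → ℝ}
    (hX : ∀ t ∈ band N, X t ≤ C) (hi : IntegrableOn X (band N)) :
    ∫ t in band N, X t ≤ 3 * N * C := by
  have h1 : ∫ t in band N, X t ≤ ∫ t in band N, C :=
    setIntegral_mono_on hi ((continuousOn_const).integrableOn_compact (isCompact_band N))
      (measurableSet_band N) hX
  refine h1.trans ?_
  rw [setIntegral_const, smul_eq_mul]
  have h2 : volume.real (band N) ≤ volume.real (Icc (-(4 * N / 3)) (4 * N / 3)) :=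
    measureReal_mono (band_subset N) (by simp)
  rw [Real.volume_real_Icc_of_le (by linarith)] at h2
  have : volume.real (band N) ≤ 3 * N := by linarith
  gcongr

lemma norm_bulkTerm_le (hg : Continuous g) (hψ : IsCutoff ψ) :
    ∃ C ≥ 0, ∀ N η, 1 ≤ N → ‖bulkTerm E g ψ N η‖ ≤ C := by
  obtain ⟨Cψ, hCψ, hbψ⟩ := hψ.bounded
  obtain ⟨Cg, hCg⟩ := (isCompact_closedBall (0 : ℝ × ℝ) π).exists_bound_of_continuousOn
    hg.continuousOn
  have hCg0 : 0 ≤ Cg := (norm_nonneg _).trans (hCg 0 (by simp [pi_nonneg]))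
  have hi : Integrable (fun u => |ψ u|) :=
    (hψ.smooth.continuous.integrable_of_hasCompactSupport hψ.hasCompactSupport).norm
  refine ⟨Cg * ∫ u, |ψ u|, by positivity, fun N η hN => ?_⟩
  rw [← integral_const_mul]
  refine (norm_integral_le_of_norm_le (hi.const_mul Cg).integrableOn
    (Filter.Eventually.of_forall fun u => ?_)).trans (setIntegral_le_integral (hi.const_mul Cg)
      (Filter.Eventually.of_forall fun u => by positivity))
  rw [norm_mul, norm_exp_neg_I_mul, mul_one, Complex.norm_real, norm_mul, Real.norm_eq_abs (ψ u)]
  by_cases hu : u ∈ Icc (-π) π ×ˢ Icc (-π) π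
  · gcongr
    refine hCg _ ?_
    rw [mem_closedBall_zero_iff, norm_smul, norm_inv, Real.norm_of_nonneg (by linarith)]
    have h1 : ‖u‖ ≤ π := by
      rw [Prod.norm_def]
      exact max_le (abs_le.2 hu.1) (abs_le.2 hu.2)
    have h2 : N⁻¹ ≤ 1 := inv_le_one_of_one_le₀ hN
    nlinarith [norm_nonneg u, pi_pos]
  · simp [hψ.eq_zero hu]

lemma BandBound.of_continuous {K : ℝ} (hK : 1 ≤ K) (hg : Continuous g) (hψ : IsCutoff ψ) :
    BandBound K (fun N _ => bulkTerm E g ψ N) fun N _ => N := by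
  refine ⟨fun N _ => continuous_bulkTerm hg hψ N, ?_⟩
  obtain ⟨C, hC, hb⟩ := norm_bulkTerm_le (E := E) hg hψ
  refine ⟨6 * C ^ 2, by positivity, fun N p q ν h hp => ?_⟩
  have hN := h.le_scale
  have hP : 0 < |p.2| := by
    by_contra h0
    nlinarith [abs_nonneg p.2]
  refine (setIntegral_band_const_le (by linarith) (sq_nonneg C)
    (fun t _ => pow_le_pow_left₀ (norm_nonneg _) (hb N _ (by linarith)) 2)
    (integrableOn_band_comp_linePoint (continuous_bulkTerm hg hψ N) p q ν N)).trans ?_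
  rw [le_div_iff₀ hP]
  have := h.abs_snd_le
  calc 3 * N * C ^ 2 * |p.2| ≤ 3 * N * C ^ 2 * 2 := by gcongr
    _ = 6 * C ^ 2 * N * 1 := by ring
    _ ≤ 6 * C ^ 2 * N * N := by gcongr; linarith
    _ = _ := by ring

end

/-- Admissible parameters. -/
structure Config where
  N : ℝ
  p : ℝ × ℝ
  q : ℝ × ℝ
  ν : ℝ
  adm : IsAdmissible N p q ν

/-- Families of continuous functions bounded on `[-4,4]`, uniformly in the parameters. -/
abbrev UnifBdd (k : Config → ℝ → ℂ) : Prop :=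
  (∀ c, Continuous (k c)) ∧ ∃ C ≥ 0, ∀ c, ∀ w ∈ Icc (-4 : ℝ) 4, ‖k c w‖ ≤ C

/-- Families of functions bounded in `C^n([-4,4])`, uniformly in the parameters. -/
@[reducible] def UnifC : ℕ → (Config → ℝ → ℂ) → Prop
  | 0, k => UnifBdd k
  | n + 1, k => UnifBdd k ∧ ∃ k' : Config → ℝ → ℂ, (∀ c w, HasDerivAt (k c) (k' c w) w) ∧ UnifC n k'

namespace UnifC

variable {n : ℕ} {k l : Config → ℝ → ℂ}

lemma bdd (h : UnifC n k) : UnifBdd k := by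
  cases n with
  | zero => exact h
  | succ n => exact h.1

lemma pred (h : UnifC (n + 1) k) : UnifC n k := by
  induction n generalizing k with
  | zero => exact h.1
  | succ n ih =>
    obtain ⟨h0, k', hk, h1⟩ := h
    exact ⟨h0, k', hk, ih h1⟩

lemma add (hk : UnifC n k) (hl : UnifC n l) : UnifC n fun c w => k c w + l c w := by
  induction n generalizing k l with
  | zero =>
    obtain ⟨c1, C1, hC1, b1⟩ := hk
    obtain ⟨c2, C2, hC2, b2⟩ := hl
    exact ⟨fun c => (c1 c).add (c2 c), C1 + C2, by positivity, fun c w hw =>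
      (norm_add_le _ _).trans (add_le_add (b1 c w hw) (b2 c w hw))⟩
  | succ n ih =>
    obtain ⟨⟨c1, C1, hC1, b1⟩, k', hk', h1⟩ := hk
    obtain ⟨⟨c2, C2, hC2, b2⟩, l', hl', h2⟩ := hl
    exact ⟨⟨fun c => (c1 c).add (c2 c), C1 + C2, by positivity, fun c w hw =>
      (norm_add_le _ _).trans (add_le_add (b1 c w hw) (b2 c w hw))⟩, _,
      fun c w => (hk' c w).add (hl' c w), ih h1 h2⟩

lemma mul (hk : UnifC n k) (hl : UnifC n l) : UnifC n fun c w => k c w * l c w := by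
  have hz : UnifBdd fun c w => k c w * l c w := by
    obtain ⟨c1, C1, hC1, b1⟩ := hk.bdd
    obtain ⟨c2, C2, hC2, b2⟩ := hl.bdd
    exact ⟨fun c => (c1 c).mul (c2 c), C1 * C2, by positivity, fun c w hw => by
      rw [norm_mul]
      exact mul_le_mul (b1 c w hw) (b2 c w hw) (norm_nonneg _) hC1⟩
  induction n generalizing k l with
  | zero => exact hz
  | succ n ih =>
    have hkp := hk.pred
    have hlp := hl.pred
    obtain ⟨h01, k', hk', h1⟩ := hk
    obtain ⟨h02, l', hl', h2⟩ := hl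
    refine ⟨hz, _, fun c w => (hk' c w).mul (hl' c w), add (ih h1 hlp ?_) (ih hkp h2 ?_)⟩
    all_goals
      obtain ⟨c1, C1, hC1, b1⟩ := h01
      obtain ⟨c2, C2, hC2, b2⟩ := h02
      obtain ⟨c3, C3, hC3, b3⟩ := h1.bdd
      obtain ⟨c4, C4, hC4, b4⟩ := h2.bdd
    · exact ⟨fun c => (c3 c).mul (c2 c), C3 * C2, by positivity, fun c w hw => by
        rw [norm_mul]
        exact mul_le_mul (b3 c w hw) (b2 c w hw) (norm_nonneg _) hC3⟩
    · exact ⟨fun c => (c1 c).mul (c4 c), C1 * C4, by positivity, fun c w hw => by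
        rw [norm_mul]
        exact mul_le_mul (b1 c w hw) (b4 c w hw) (norm_nonneg _) hC1⟩

lemma const {z : Config → ℂ} {C : ℝ} (hC : 0 ≤ C) (hz : ∀ c, ‖z c‖ ≤ C) :
    UnifC n fun c _ => z c := by
  induction n generalizing z C with
  | zero => exact ⟨fun c => continuous_const, C, hC, fun c _ _ => hz c⟩
  | succ n ih =>
    exact ⟨⟨fun c => continuous_const, C, hC, fun c _ _ => hz c⟩, fun _ _ => 0,
      fun c w => hasDerivAt_const w (z c), ih le_rfl (by simp)⟩

lemma id : UnifC n fun _ w => (w : ℂ) := by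
  have h0 : UnifBdd fun _ w => (w : ℂ) :=
    ⟨fun _ => Complex.continuous_ofReal, 4, by norm_num, fun c w hw => by
      rw [Complex.norm_real]; exact abs_le.2 hw⟩
  cases n with
  | zero => exact h0
  | succ n =>
    exact ⟨h0, fun _ _ => 1, fun _ w => (hasDerivAt_id w).ofReal_comp,
      const zero_le_one (by simp)⟩

lemma cexp (hk : UnifC n k) : UnifC n fun c w => Complex.exp (k c w) := by
  have hz : UnifBdd fun c w => Complex.exp (k c w) := by
    obtain ⟨c1, C1, hC1, b1⟩ := hk.bdd
    exact ⟨fun c => (c1 c).cexp, Real.exp C1, by positivity, fun c w hw =>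
      (Complex.norm_exp_le_exp_norm _).trans (Real.exp_le_exp.2 (b1 c w hw))⟩
  induction n generalizing k with
  | zero => exact hz
  | succ n ih =>
    have hkp := hk.pred
    obtain ⟨h01, k', hk', h1⟩ := hk
    exact ⟨hz, _, fun c w => (hk' c w).cexp, (ih hkp hz).mul h1⟩

lemma inv_scale : UnifC n fun c _ => ((c.N⁻¹ : ℝ) : ℂ) :=
  const zero_le_one fun c => by
    have := c.adm.le_scale
    rw [Complex.norm_real, norm_inv, Real.norm_of_nonneg (by linarith)]
    exact inv_le_one_of_one_le₀ (by linarith)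

end UnifC

lemma Config.inv_mul_mem (c : Config) {w : ℝ} (hw : w ∈ Icc (-4 : ℝ) 4) :
    c.N⁻¹ * w ∈ Icc (-4 : ℝ) 4 := by
  have h1 := c.adm.le_scale
  have h2 : c.N⁻¹ ≤ 1 := inv_le_one_of_one_le₀ (by linarith)
  have h3 : 0 ≤ c.N⁻¹ := inv_nonneg.2 (by linarith)
  constructor <;> nlinarith [hw.1, hw.2]

lemma unifC_comp_inv_mul {n : ℕ} {F : ℝ → ℝ} (hF : ContDiff ℝ n F) :
    UnifC n fun c w => (F (c.N⁻¹ * w) : ℂ) := by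
  have h0 : UnifBdd fun c w => (F (c.N⁻¹ * w) : ℂ) := by
    have hc := hF.continuous
    obtain ⟨C, hC⟩ := (isCompact_Icc (a := (-4 : ℝ)) (b := 4)).exists_bound_of_continuousOn
      hc.continuousOn
    refine ⟨fun c => by fun_prop, C, (norm_nonneg _).trans (hC 0 (by norm_num)),
      fun c w hw => ?_⟩
    rw [Complex.norm_real]
    exact hC _ (c.inv_mul_mem hw)
  induction n generalizing F with
  | zero => exact h0
  | succ n ih =>
    have hd : ContDiff ℝ n (deriv F) := by
      have := hF
      push_cast at this
      exact (contDiff_succ_iff_deriv.1 this).2.2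
    refine ⟨h0, fun c w => ((deriv F (c.N⁻¹ * w) : ℝ) : ℂ) * ((c.N⁻¹ : ℝ) : ℂ), fun c w => ?_,
      (ih hd ?_).mul UnifC.inv_scale⟩
    · have h1 : HasDerivAt F (deriv F (c.N⁻¹ * w)) (c.N⁻¹ * w) :=
        (hF.differentiable (by norm_num) _).hasDerivAt
      have h2 := h1.comp w ((hasDerivAt_id w).const_mul c.N⁻¹)
      rw [mul_one] at h2
      exact_mod_cast h2.ofReal_comp
    · have hc := hd.continuous
      obtain ⟨C, hC⟩ := (isCompact_Icc (a := (-4 : ℝ)) (b := 4)).exists_bound_of_continuousOn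
        hc.continuousOn
      refine ⟨fun c => by fun_prop, C, (norm_nonneg _).trans (hC 0 (by norm_num)),
        fun c w hw => ?_⟩
      rw [Complex.norm_real]
      exact hC _ (c.inv_mul_mem hw)

/-- A differentiable function vanishing at the origin grows at most linearly on `[-4,4]`. -/
lemma abs_le_mul_abs_of_deriv_le {H : ℝ → ℝ} {C : ℝ} (hH : Differentiable ℝ H) (h0 : H 0 = 0)
    (hC : ∀ x ∈ Icc (-4 : ℝ) 4, |deriv H x| ≤ C) {x : ℝ} (hx : x ∈ Icc (-4 : ℝ) 4) :
    |H x| ≤ C * |x| := by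
  have := (convex_Icc (-4 : ℝ) 4).norm_image_sub_le_of_norm_deriv_le (f := H)
    (fun y _ => hH y) hC (by norm_num : (0 : ℝ) ∈ Icc (-4 : ℝ) 4) hx
  simpa [h0] using this

lemma unifC_scale_mul {n : ℕ} {H : ℝ → ℝ} (hH : ContDiff ℝ (n + 1 : ℕ) H) (h0 : H 0 = 0) :
    UnifC (n + 1) fun c w => ((c.N * H (c.N⁻¹ * w) : ℝ) : ℂ) := by
  have hd : ContDiff ℝ n (deriv H) := by
    have := hH
    push_cast at this
    exact (contDiff_succ_iff_deriv.1 this).2.2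
  have hdiff : Differentiable ℝ H := hH.differentiable (by norm_num)
  refine ⟨?_, fun c w => ((deriv H (c.N⁻¹ * w) : ℝ) : ℂ), fun c w => ?_, unifC_comp_inv_mul hd⟩
  · obtain ⟨C, hC⟩ := (isCompact_Icc (a := (-4 : ℝ)) (b := 4)).exists_bound_of_continuousOn
      hd.continuous.continuousOn
    have hC0 : 0 ≤ C := (norm_nonneg _).trans (hC 0 (by norm_num))
    have hc := hH.continuous
    refine ⟨fun c => by fun_prop, C * 4, by positivity, fun c w hw => ?_⟩
    have hN := c.adm.pos
    rw [Complex.norm_real, norm_mul, Real.norm_of_nonneg hN.le]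
    calc c.N * |H (c.N⁻¹ * w)| ≤ c.N * (C * |c.N⁻¹ * w|) := by
          gcongr
          exact abs_le_mul_abs_of_deriv_le hdiff h0 hC (c.inv_mul_mem hw)
      _ = C * |w| := by
          rw [abs_mul, abs_inv, abs_of_pos hN]; field_simp
      _ ≤ C * 4 := by gcongr; exact abs_le.2 hw
  · exact (hasDerivAt_scaledCurve hdiff c.adm.pos.ne' w).ofReal_comp

lemma unifC_cutoff {E : ℝ → ℝ} (hE : ContDiff ℝ 2 E) {ψ : ℝ × ℝ → ℝ} (hψ : IsCutoff ψ) :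
    UnifC 2 fun c w => (ψ (scaledCurve E c.N w, w) : ℂ) := by
  have hE' : UnifC 1 fun c w => ((deriv E (c.N⁻¹ * w) : ℝ) : ℂ) :=
    unifC_comp_inv_mul ((contDiff_succ_iff_deriv (n := 1)).1 hE).2.2
  have hz : ∀ ψ : ℝ × ℝ → ℝ, IsCutoff ψ →
      UnifBdd fun c w => (ψ (scaledCurve E c.N w, w) : ℂ) := by
    intro ψ hψ
    obtain ⟨C, hC, hb⟩ := hψ.bounded
    have h1 := hψ.smooth.continuous
    refine ⟨fun c => ?_, C, hC, fun c w _ => by rw [Complex.norm_real]; exact hb _⟩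
    have := continuous_scaledCurve hE.continuous c.N
    fun_prop
  have hd : ∀ ψ : ℝ × ℝ → ℝ, IsCutoff ψ → ∀ (c : Config) w,
      HasDerivAt (fun w => (ψ (scaledCurve E c.N w, w) : ℂ))
      (((deriv E (c.N⁻¹ * w) : ℝ) : ℂ) * (dirDeriv (1, 0) ψ (scaledCurve E c.N w, w) : ℂ) +
        (dirDeriv (0, 1) ψ (scaledCurve E c.N w, w) : ℂ)) w := by
    intro ψ hψ c w
    have h1 : HasFDerivAt ψ (fderiv ℝ ψ (scaledCurve E c.N w, w)) (scaledCurve E c.N w, w) :=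
      (hψ.smooth.differentiable (by norm_num) _).hasFDerivAt
    have h2 := (hasDerivAt_scaledCurve (hE.differentiable (by norm_num)) c.adm.pos.ne' w).prodMk
      (hasDerivAt_id w)
    have h3 := (h1.comp_hasDerivAt (f := fun w => (scaledCurve E c.N w, w)) w h2).ofReal_comp
    refine h3.congr_deriv ?_
    have := dirDeriv_eq (deriv E (c.N⁻¹ * w), 1) ψ (scaledCurve E c.N w, w)
    rw [dirDeriv] at this
    rw [this]
    push_cast
    ring
  have h1 : ∀ ψ : ℝ × ℝ → ℝ, IsCutoff ψ →
      UnifC 1 fun c w => (ψ (scaledCurve E c.N w, w) : ℂ) := fun ψ hψ =>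
    ⟨hz ψ hψ, _, hd ψ hψ, (hE'.pred.mul (hz _ (hψ.dirDeriv _))).add (hz _ (hψ.dirDeriv _))⟩
  exact ⟨hz ψ hψ, _, hd ψ hψ, (hE'.mul (h1 _ (hψ.dirDeriv _))).add (h1 _ (hψ.dirDeriv _))⟩

/-- The phase of the boundary integrals. -/
def Config.phase (E : ℝ → ℝ) (c : Config) (w : ℝ) : ℝ :=
  c.p.1 * scaledCurve E c.N w + c.p.2 * w

lemma exists_isPhase {E : ℝ → ℝ} (hE : ContDiff ℝ 2 E) (hE0' : deriv E 0 = 0) :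
    ∃ K ≥ 1, ∀ c : Config, K ≤ c.N * |c.p.2| → ∃ b b',
      IsPhase (c.phase E) b b' c.p.2 (K / (c.N * |c.p.2|)) := by
  have hd : ContDiff ℝ 1 (deriv E) := ((contDiff_succ_iff_deriv (n := 1)).1 hE).2.2
  have hd2 : Continuous (deriv (deriv E)) := hd.continuous_deriv le_rfl
  obtain ⟨M, hM⟩ := (isCompact_Icc (a := (-4 : ℝ)) (b := 4)).exists_bound_of_continuousOn
      hd2.continuousOn
  have hM0 : 0 ≤ M := (norm_nonneg _).trans (hM 0 (by norm_num))
  refine ⟨16 * M + 1, by linarith, fun c hK => ?_⟩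
  have hN := c.adm.pos
  have hσ : 0 < c.N * |c.p.2| := by linarith
  have hP : 0 < |c.p.2| := pos_of_mul_pos_right hσ hN.le
  have hp2 : c.p.2 ≠ 0 := abs_pos.1 hP
  have hp1 := c.adm.abs_fst_le
  refine ⟨fun w => 1 + c.p.1 / c.p.2 * deriv E (c.N⁻¹ * w),
    fun w => c.p.1 / c.p.2 * (deriv (deriv E) (c.N⁻¹ * w) * c.N⁻¹), ?_, ?_, ?_, ?_, ?_, hp2⟩
  · intro w
    refine (((hasDerivAt_scaledCurve (hE.differentiable (by norm_num)) hN.ne' w).const_mul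
      c.p.1).add ((hasDerivAt_id w).const_mul c.p.2)).congr_deriv ?_
    field_simp
    ring
  · intro w
    have h1 : HasDerivAt (deriv E) (deriv (deriv E) (c.N⁻¹ * w)) (c.N⁻¹ * w) :=
      (hd.differentiable (by norm_num) _).hasDerivAt
    have h2 := h1.comp w ((hasDerivAt_id w).const_mul c.N⁻¹)
    rw [mul_one] at h2
    exact (h2.const_mul _).const_add 1
  · fun_prop
  · intro w hw
    have h1 := abs_le_mul_abs_of_deriv_le (hd.differentiable (by norm_num)) hE0' hM
      (c.inv_mul_mem hw)
    have h2 : |c.p.1 / c.p.2 * deriv E (c.N⁻¹ * w)| ≤ 1 / 2 := by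
      rw [abs_mul, abs_div]
      calc |c.p.1| / |c.p.2| * |deriv E (c.N⁻¹ * w)|
          ≤ 2 / |c.p.2| * (M * |c.N⁻¹ * w|) := by gcongr
        _ = 2 * M * |w| / (c.N * |c.p.2|) := by
          rw [abs_mul, abs_inv, abs_of_pos hN]; field_simp
        _ ≤ 2 * M * 4 / (c.N * |c.p.2|) := by gcongr; exact abs_le.2 hw
        _ ≤ 1 / 2 := by
          rw [div_le_iff₀ hσ]; linarith
    have := (abs_le.1 h2).1
    linarith
  · intro w hw
    have h1 := hM _ (c.inv_mul_mem hw)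
    rw [Real.norm_eq_abs] at h1
    rw [abs_mul, abs_div, abs_mul, abs_inv, abs_of_pos hN]
    calc |c.p.1| / |c.p.2| * (|deriv (deriv E) (c.N⁻¹ * w)| * c.N⁻¹)
        ≤ 2 / |c.p.2| * (M * c.N⁻¹) := by gcongr
      _ = 2 * M / (c.N * |c.p.2|) := by field_simp
      _ ≤ _ := by gcongr; linarith

lemma bandInt_le_of_unifBdd {E : ℝ → ℝ} {K : ℝ} {κ : Config → ℝ → ℂ}
    (hK : ∀ c : Config, K ≤ c.N * |c.p.2| → ∃ b b',
      IsPhase (c.phase E) b b' c.p.2 (K / (c.N * |c.p.2|)))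
    (hκ : UnifBdd κ) :
    ∃ C ≥ 0, ∀ c : Config, K ≤ c.N * |c.p.2| →
      ∫ t in band c.N, ‖oscInt (c.phase E) (κ c) t‖ ^ 2 ≤ C / |c.p.2| := by
  obtain ⟨hc, M, hM, hb⟩ := hκ
  refine ⟨400 * M ^ 2, by positivity, fun c h => ?_⟩
  obtain ⟨b, b', hP⟩ := hK c h
  exact hP.setIntegral_band_le c.adm.pos (hc c).continuousOn (hb c)

/-- A function vanishing for `|w| > π` has vanishing derivative at `±4`. -/
lemma HasDerivAt.eq_zero_of_eq_zero_of_lt {κ κ' : ℝ → ℂ} (h : ∀ w, HasDerivAt κ (κ' w) w)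
    (h0 : ∀ w, π < |w| → κ w = 0) {w : ℝ} (hw : π < |w|) : κ' w = 0 := by
  have hev : κ =ᶠ[nhds w] fun _ => 0 := by
    filter_upwards [(isOpen_lt continuous_const continuous_abs).mem_nhds hw] with x hx
    exact h0 x hx
  exact (h w).unique ((hasDerivAt_const w (0 : ℂ)).congr_of_eventuallyEq hev)

lemma pi_lt_abs_four : π < |(4 : ℝ)| ∧ π < |(-4 : ℝ)| := by
  rw [abs_neg, abs_of_pos (by norm_num : (0 : ℝ) < 4)]
  exact ⟨pi_lt_four, pi_lt_four⟩

lemma bandInt_le_of_unifC_one {E : ℝ → ℝ} {K : ℝ} {κ : Config → ℝ → ℂ} (hK1 : 1 ≤ K)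
    (hK : ∀ c : Config, K ≤ c.N * |c.p.2| → ∃ b b',
      IsPhase (c.phase E) b b' c.p.2 (K / (c.N * |c.p.2|)))
    (hκ : UnifC 1 κ) (h0 : ∀ c w, π < |w| → κ c w = 0) :
    ∃ C ≥ 0, ∀ c : Config, K ≤ c.N * |c.p.2| →
      ∫ t in band c.N, ‖oscInt (c.phase E) (κ c) t‖ ^ 2 ≤
        C / |c.p.2| * (1 / (c.N * |c.p.2|)) ^ 2 := by
  obtain ⟨⟨hc, M, hM, hb⟩, κ', hd, hc', M', hM', hb'⟩ := hκ
  set m := max M M' with hm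
  have hm0 : 0 ≤ m := hM.trans (le_max_left _ _)
  refine ⟨400 * (6 * m) ^ 2 * 9, by positivity, fun c h => ?_⟩
  obtain ⟨b, b', hP⟩ := hK c h
  have hσ : 0 < c.N * |c.p.2| := by linarith
  have hB : K / (c.N * |c.p.2|) ≤ 1 := div_le_one_of_le₀ h hσ.le
  refine (hP.setIntegral_band_le_of_deriv c.adm.pos (fun w _ => hd c w) (hc' c).continuousOn
    (h0 c _ pi_lt_abs_four.2) (h0 c _ pi_lt_abs_four.1)
    (fun w hw => (hb c w hw).trans (le_max_left M M'))
    (fun w hw => (hb' c w hw).trans (le_max_right M M'))).trans ?_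
  rw [← hm]
  have h1 : m * (K / (c.N * |c.p.2|)) ≤ m := mul_le_of_le_one_right hm0 hB
  have h2 : 0 ≤ m * (K / (c.N * |c.p.2|)) := by positivity
  calc _ ≤ 400 * (6 * m) ^ 2 / |c.p.2| * (3 / (c.N * |c.p.2|)) ^ 2 := by
        gcongr; linarith
    _ = _ := by ring

lemma bandInt_le_of_unifC_two {E : ℝ → ℝ} {K : ℝ} {κ : Config → ℝ → ℂ} (hK1 : 1 ≤ K)
    (hK : ∀ c : Config, K ≤ c.N * |c.p.2| → ∃ b b',
      IsPhase (c.phase E) b b' c.p.2 (K / (c.N * |c.p.2|)))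
    (hκ : UnifC 2 κ) (h0 : ∀ c w, π < |w| → κ c w = 0) :
    ∃ C ≥ 0, ∀ c : Config, K ≤ c.N * |c.p.2| →
      ∫ t in band c.N, ‖oscInt (c.phase E) (κ c) t‖ ^ 2 ≤
        C / |c.p.2| * (1 / (c.N * |c.p.2|)) ^ 4 := by
  obtain ⟨⟨hc, M, hM, hb⟩, κ', hd, ⟨hc', M', hM', hb'⟩, κ'', hd', hc'', M'', hM'', hb''⟩ := hκ
  have h0' : ∀ c w, π < |w| → κ' c w = 0 := fun c w =>
    HasDerivAt.eq_zero_of_eq_zero_of_lt (hd c) (h0 c)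
  set m := max M (max M' M'') with hm
  have hm0 : 0 ≤ m := hM.trans (le_max_left _ _)
  refine ⟨800 * (36 * m) ^ 2 * 81 + 800 * (4 * (m * K)) ^ 2 * 9, by positivity, fun c h => ?_⟩
  obtain ⟨b, b', hP⟩ := hK c h
  have hσ : 0 < c.N * |c.p.2| := by linarith
  have hB : K / (c.N * |c.p.2|) ≤ 1 := div_le_one_of_le₀ h hσ.le
  refine (hP.setIntegral_band_le_of_deriv_two c.adm.pos (fun w _ => hd c w) (fun w _ => hd' c w)
    (hc'' c).continuousOn
    (h0 c _ pi_lt_abs_four.2) (h0 c _ pi_lt_abs_four.1)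
    (h0' c _ pi_lt_abs_four.2) (h0' c _ pi_lt_abs_four.1)
    (fun w hw => (hb c w hw).trans (le_max_left M (max M' M'')))
    (fun w hw => (hb' c w hw).trans ((le_max_left M' M'').trans (le_max_right M (max M' M''))))
    (fun w hw => (hb'' c w hw).trans
      ((le_max_right M' M'').trans (le_max_right M (max M' M''))))).trans ?_
  rw [← hm]
  set B := K / (c.N * |c.p.2|) with hBdef
  have hB0 : 0 ≤ B := by positivity
  have h1 : m * B ≤ m := mul_le_of_le_one_right hm0 hB
  have h2 : m * B ^ 2 ≤ m := mul_le_of_le_one_right hm0 (pow_le_one₀ hB0 hB)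
  calc _ ≤ 800 * (36 * m) ^ 2 / |c.p.2| * (3 / (c.N * |c.p.2|)) ^ 4 +
        800 * (4 * (m * B)) ^ 2 / |c.p.2| * (3 / (c.N * |c.p.2|)) ^ 2 := by
        gcongr; linarith
    _ = _ := by rw [hBdef]; ring

/-- The amplitude of the boundary integrals. -/
def Config.amplitude (E : ℝ → ℝ) (g ψ : ℝ × ℝ → ℝ) (c : Config) (w : ℝ) : ℂ :=
  ((g (E (c.N⁻¹ * w), c.N⁻¹ * w) : ℝ) : ℂ) * ((ψ (scaledCurve E c.N w, w) : ℝ) : ℂ) *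
    Complex.exp ((c.ν : ℂ) * (-Complex.I) *
      ((c.q.1 : ℂ) * ((scaledCurve E c.N w : ℝ) : ℂ) + (c.q.2 : ℂ) * (w : ℂ)))

/-- The rescaled slope of the curve. -/
def Config.slope (E : ℝ → ℝ) (c : Config) (w : ℝ) : ℂ :=
  ((c.N * deriv E (c.N⁻¹ * w) : ℝ) : ℂ)

section

variable {E : ℝ → ℝ} {g ψ : ℝ × ℝ → ℝ}

lemma unifC_amplitude {n : ℕ} (hn : n ≤ 2) (hE : ContDiff ℝ 2 E) (hE0 : E 0 = 0)
    (hg : ContDiff ℝ n g) (hψ : IsCutoff ψ) : UnifC n (Config.amplitude E g ψ) := by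
  have down : ∀ {k : Config → ℝ → ℂ}, UnifC 2 k → UnifC n k := by
    intro k hk
    interval_cases n
    · exact hk.bdd
    · exact hk.pred
    · exact hk
  have hEn : ContDiff ℝ n E := hE.of_le (by exact_mod_cast hn)
  have h1 : UnifC n fun c w => ((g (E (c.N⁻¹ * w), c.N⁻¹ * w) : ℝ) : ℂ) :=
    unifC_comp_inv_mul (F := fun x => g (E x, x)) (hg.comp (hEn.prodMk contDiff_id))
  have h2 : UnifC 2 fun c w => ((scaledCurve E c.N w : ℝ) : ℂ) :=
    unifC_scale_mul (n := 1) (by exact_mod_cast hE) hE0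
  have hq : ∀ {x y : ℝ}, x ^ 2 + y ^ 2 ≤ 1 → ‖(x : ℂ)‖ ≤ 1 := fun {x y} h => by
    rw [Complex.norm_real]
    exact abs_le_of_sq_le_sq (by nlinarith [sq_nonneg y]) zero_le_one
  have h3 : UnifC 2 fun c w => (c.ν : ℂ) * (-Complex.I) *
      ((c.q.1 : ℂ) * ((scaledCurve E c.N w : ℝ) : ℂ) + (c.q.2 : ℂ) * (w : ℂ)) := by
    refine UnifC.mul (UnifC.const (z := fun c => (c.ν : ℂ) * (-Complex.I)) zero_le_one fun c => ?_)
      ((UnifC.mul (UnifC.const (z := fun c => (c.q.1 : ℂ)) zero_le_one fun c => ?_) h2).add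
      (UnifC.mul (UnifC.const (z := fun c => (c.q.2 : ℂ)) zero_le_one fun c => ?_) UnifC.id))
    · simpa using c.adm.abs_le
    · exact hq c.adm.le_one
    · exact hq (x := c.q.2) (y := c.q.1) (by linarith [c.adm.le_one])
  exact (h1.mul (down (unifC_cutoff hE hψ))).mul (down h3.cexp)

lemma unifC_slope (hE : ContDiff ℝ 2 E) (hE0' : deriv E 0 = 0) : UnifC 1 (Config.slope E) :=
  unifC_scale_mul (n := 0) (by exact_mod_cast ((contDiff_succ_iff_deriv (n := 1)).1 hE).2.2) hE0'

lemma amplitude_eq_zero (hψ : IsCutoff ψ) (c : Config) (w : ℝ) (hw : π < |w|) :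
    c.amplitude E g ψ w = 0 := by
  simp [Config.amplitude, hψ.eq_zero_of_lt hw]

lemma lineTerm_eq_oscInt (hE : ContDiff ℝ 2 E) (hE0 : E 0 = 0) (hE0' : deriv E 0 = 0)
    (hg : Continuous g) (hψ : IsCutoff ψ) (c : Config) (t : ℝ) :
    lineTerm E g ψ c.N c.p (linePoint c.p c.q c.ν t) =
      (c.p.1 : ℂ) * oscInt (c.phase E) (c.amplitude E g ψ) t -
        ((c.p.2 / c.N : ℝ) : ℂ) *
          oscInt (c.phase E) (fun w => c.slope E w * c.amplitude E g ψ w) t := by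
  have hA := (unifC_amplitude (n := 0) (by norm_num) hE hE0 (by simpa using hg) hψ).1 c
  have hF := (unifC_slope hE hE0').1.1 c
  have hph : Continuous (c.phase E) := by
    have := continuous_scaledCurve hE.continuous c.N
    unfold Config.phase
    fun_prop
  have hN : (c.N : ℂ) ≠ 0 := by exact_mod_cast c.adm.pos.ne'
  rw [oscInt, oscInt, ← integral_const_mul, ← integral_const_mul, ← integral_sub, lineTerm,
    edgeLine, ← setIntegral_eq_integral_of_forall_compl_eq_zero (s := Icc (-4 : ℝ) 4)]
  · refine integral_congr_ae (Filter.Eventually.of_forall fun w => ?_)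
    have he : Complex.exp (-(Complex.I * (((linePoint c.p c.q c.ν t).1 * scaledCurve E c.N w +
          (linePoint c.p c.q c.ν t).2 * w : ℝ) : ℂ))) =
        Complex.exp ((c.ν : ℂ) * (-Complex.I) *
          ((c.q.1 : ℂ) * ((scaledCurve E c.N w : ℝ) : ℂ) + (c.q.2 : ℂ) * (w : ℂ))) *
        Complex.exp (-(Complex.I * ((t * c.phase E w : ℝ) : ℂ))) := by
      rw [← Complex.exp_add]
      congr 1
      simp only [linePoint, Config.phase]
      push_cast
      ring
    simp only [he, Config.amplitude, Config.slope]
    push_cast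
    field_simp
  · intro w hw
    have : π < |w| := by
      by_contra h
      exact hw (abs_le.1 ((not_lt.1 h).trans pi_lt_four.le))
    simp [hψ.eq_zero_of_lt this]
  · exact (by fun_prop : Continuous _).integrableOn_Icc
  · exact (by fun_prop : Continuous _).integrableOn_Icc

lemma setIntegral_norm_lineTerm_le (hE : ContDiff ℝ 2 E) (hE0 : E 0 = 0) (hE0' : deriv E 0 = 0)
    (hg : Continuous g) (hψ : IsCutoff ψ) (c : Config) :
    ∫ t in band c.N, ‖lineTerm E g ψ c.N c.p (linePoint c.p c.q c.ν t)‖ ^ 2 ≤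
      8 * (∫ t in band c.N, ‖oscInt (c.phase E) (c.amplitude E g ψ) t‖ ^ 2) +
      2 * (c.p.2 / c.N) ^ 2 * ∫ t in band c.N,
        ‖oscInt (c.phase E) (fun w => c.slope E w * c.amplitude E g ψ w) t‖ ^ 2 := by
  have hA := (unifC_amplitude (n := 0) (by norm_num) hE hE0 (by simpa using hg) hψ).1 c
  have hF := (unifC_slope hE hE0').1.1 c
  have hph : Continuous (c.phase E) := by
    have := continuous_scaledCurve hE.continuous c.N
    unfold Config.phase
    fun_prop
  have c1 := continuous_oscInt hA.continuousOn hph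
  have c2 : Continuous (oscInt (c.phase E) fun w => c.slope E w * c.amplitude E g ψ w) :=
    continuous_oscInt (hF.mul hA).continuousOn hph
  have i1 := integrableOn_band_norm_sq c1 c.N
  have i2 := integrableOn_band_norm_sq c2 c.N
  rw [← integral_const_mul, ← integral_const_mul, ← integral_add (i1.const_mul _) (i2.const_mul _)]
  refine setIntegral_mono_on
    (integrableOn_band_comp_linePoint (continuous_lineTerm (hE.of_le (by norm_num)) hg hψ c.N c.p)
      c.p c.q c.ν c.N) ((i1.const_mul _).add (i2.const_mul _)) (measurableSet_band _) fun t _ => ?_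
  rw [lineTerm_eq_oscInt hE hE0 hE0' hg hψ c t]
  set x := oscInt (c.phase E) (c.amplitude E g ψ) t
  set y := oscInt (c.phase E) (fun w => c.slope E w * c.amplitude E g ψ w) t
  have h1 : ‖(c.p.1 : ℂ) * x - ((c.p.2 / c.N : ℝ) : ℂ) * y‖ ≤
      2 * ‖x‖ + |c.p.2 / c.N| * ‖y‖ := by
    refine (norm_sub_le _ _).trans ?_
    rw [norm_mul, norm_mul, Complex.norm_real, Complex.norm_real]
    exact add_le_add (mul_le_mul_of_nonneg_right c.adm.abs_fst_le (norm_nonneg _)) le_rfl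
  refine (pow_le_pow_left₀ (norm_nonneg _) h1 2).trans ?_
  rw [← sq_abs (c.p.2 / c.N)]
  nlinarith [sq_nonneg (2 * ‖x‖ - |c.p.2 / c.N| * ‖y‖)]

lemma bandBound_lineTerm_of_continuous {K : ℝ} (hE : ContDiff ℝ 2 E) (hE0 : E 0 = 0)
    (hE0' : deriv E 0 = 0)
    (hK : ∀ c : Config, K ≤ c.N * |c.p.2| → ∃ b b',
      IsPhase (c.phase E) b b' c.p.2 (K / (c.N * |c.p.2|)))
    (hg : Continuous g) (hψ : IsCutoff ψ) :
    BandBound K (lineTerm E g ψ) fun _ _ => 1 := by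
  refine ⟨fun N p => continuous_lineTerm (hE.of_le (by norm_num)) hg hψ N p, ?_⟩
  have hA := unifC_amplitude (n := 0) (by norm_num) hE hE0 (by simpa using hg) hψ
  have hF : UnifC 0 _ := (unifC_slope hE hE0').1
  obtain ⟨C1, hC1, b1⟩ := bandInt_le_of_unifBdd hK hA
  obtain ⟨C2, hC2, b2⟩ := bandInt_le_of_unifBdd hK (hF.mul hA)
  refine ⟨8 * C1 + 2 * C2, by positivity, fun N p q ν h hp => ?_⟩
  set c : Config := ⟨N, p, q, ν, h⟩
  refine (setIntegral_norm_lineTerm_le hE hE0 hE0' hg hψ c).trans ?_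
  have h3 : (c.p.2 / c.N) ^ 2 ≤ 1 := by
    rw [← sq_abs, abs_div, abs_of_pos c.adm.pos]
    refine pow_le_one₀ (div_nonneg (abs_nonneg _) c.adm.pos.le) (div_le_one_of_le₀ ?_ c.adm.pos.le)
    linarith [c.adm.abs_snd_le, c.adm.le_scale]
  calc _ ≤ 8 * (C1 / |c.p.2|) + 2 * 1 * (C2 / |c.p.2|) := by
        gcongr
        · exact b1 c hp
        · exact b2 c hp
    _ = _ := by ring

lemma bandBound_lineTerm_of_contDiff {K : ℝ} (hE : ContDiff ℝ 2 E) (hE0 : E 0 = 0)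
    (hE0' : deriv E 0 = 0) (hK1 : 1 ≤ K)
    (hK : ∀ c : Config, K ≤ c.N * |c.p.2| → ∃ b b',
      IsPhase (c.phase E) b b' c.p.2 (K / (c.N * |c.p.2|)))
    (hg : ContDiff ℝ 2 g) (hψ : IsCutoff ψ) :
    BandBound K (lineTerm E g ψ) fun _ σ => 1 / σ ^ 2 := by
  refine ⟨fun N p => continuous_lineTerm (hE.of_le (by norm_num)) hg.continuous hψ N p, ?_⟩
  have hA := unifC_amplitude (n := 2) le_rfl hE hE0 hg hψ
  obtain ⟨C1, hC1, b1⟩ := bandInt_le_of_unifC_two hK1 hK hA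
    fun c w hw => amplitude_eq_zero hψ c w hw
  obtain ⟨C2, hC2, b2⟩ := bandInt_le_of_unifC_one hK1 hK ((unifC_slope hE hE0').mul hA.pred)
    fun c w hw => by rw [amplitude_eq_zero hψ c w hw, mul_zero]
  refine ⟨8 * C1 + 2 * C2 * 16, by positivity, fun N p q ν h hp => ?_⟩
  set c : Config := ⟨N, p, q, ν, h⟩
  refine (setIntegral_norm_lineTerm_le hE hE0 hE0' hg.continuous hψ c).trans ?_
  have hN := c.adm.pos
  have hσ : 0 < c.N * |c.p.2| := by
    have : K ≤ c.N * |c.p.2| := hp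
    linarith
  have hP : 0 < |c.p.2| := pos_of_mul_pos_right hσ hN.le
  have h3 : (c.p.2 / c.N) ^ 2 ≤ 16 * (1 / (c.N * |c.p.2|)) ^ 2 := by
    rw [← sq_abs, abs_div, abs_of_pos hN, div_pow, div_pow, mul_pow, one_pow, mul_one_div,
      div_le_div_iff₀ (by positivity) (by positivity)]
    have h4 : |c.p.2| ^ 2 ≤ 2 ^ 2 := pow_le_pow_left₀ hP.le c.adm.abs_snd_le 2
    calc |c.p.2| ^ 2 * (c.N ^ 2 * |c.p.2| ^ 2) ≤ 2 ^ 2 * (c.N ^ 2 * 2 ^ 2) := by gcongr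
      _ = _ := by ring
  calc _ ≤ 8 * (C1 / |c.p.2| * (1 / (c.N * |c.p.2|)) ^ 4) +
        2 * (16 * (1 / (c.N * |c.p.2|)) ^ 2) * (C2 / |c.p.2| * (1 / (c.N * |c.p.2|)) ^ 2) := by
        gcongr
        · exact b1 c hp
        · exact b2 c hp
    _ = _ := by simp only [c]; ring

end

section

variable {E : ℝ → ℝ} {f ψ : ℝ × ℝ → ℝ} {K : ℝ}

lemma bandBound_bulkTerm_of_contDiff_one (hE : ContDiff ℝ 2 E) (hE0 : E 0 = 0)
    (hE0' : deriv E 0 = 0) (hK1 : 1 ≤ K)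
    (hK : ∀ c : Config, K ≤ c.N * |c.p.2| → ∃ b b',
      IsPhase (c.phase E) b b' c.p.2 (K / (c.N * |c.p.2|)))
    (hf : ContDiff ℝ 1 f) (hψ : IsCutoff ψ) :
    BandBound K (fun N _ => bulkTerm E f ψ N) fun N _ => 1 / N := by
  have hE1 : ContDiff ℝ 1 E := hE.of_le (by norm_num)
  have hd : ∀ d, Continuous (dirDeriv d f) := fun d =>
    (contDiff_dirDeriv (n := 0) (by simpa using hf) d).continuous
  have hL := fun ψ (hψ : IsCutoff ψ) =>
    bandBound_lineTerm_of_continuous hE hE0 hE0' hK hf.continuous hψ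
  have h0 := fun ψ (hψ : IsCutoff ψ) => BandBound.of_continuous (E := E) hK1 hf.continuous hψ
  have h0' := fun ψ (hψ : IsCutoff ψ) d => BandBound.of_continuous (E := E) hK1 (hd d) hψ
  have h1 : ∀ ψ, IsCutoff ψ → BandBound K (fun N _ => bulkTerm E f ψ N) fun _ _ => 1 :=
    fun ψ hψ => .of_step (c := 3) hE1 hf hψ (hL ψ hψ) (h0' ψ hψ)
      (fun d => h0 _ (hψ.dirDeriv d)) (by norm_num) fun N σ hN _ _ _ => by
        have : N ≠ 0 := by linarith
        field_simp
        nlinarith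
  exact .of_step (c := 3) hE1 hf hψ (hL ψ hψ) (h0' ψ hψ)
      (fun d => h1 _ (hψ.dirDeriv d)) (by norm_num) fun N σ hN _ _ _ => by
        have : N ≠ 0 := by linarith
        field_simp
        norm_num

lemma bandBound_bulkTerm_of_contDiff_two (hE : ContDiff ℝ 2 E) (hE0 : E 0 = 0)
    (hE0' : deriv E 0 = 0) (hK1 : 1 ≤ K)
    (hK : ∀ c : Config, K ≤ c.N * |c.p.2| → ∃ b b',
      IsPhase (c.phase E) b b' c.p.2 (K / (c.N * |c.p.2|)))
    (hf : ContDiff ℝ 2 f) (hψ : IsCutoff ψ) :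
    BandBound K (fun N _ => bulkTerm E f ψ N) fun N σ => 1 / (N * σ ^ 2) := by
  have hE1 : ContDiff ℝ 1 E := hE.of_le (by norm_num)
  have hf1 : ContDiff ℝ 1 f := hf.of_le (by norm_num)
  have hd : ∀ d, ContDiff ℝ 1 (dirDeriv d f) := fun d =>
    contDiff_dirDeriv (n := 1) (by exact_mod_cast hf) d
  have hL := fun ψ (hψ : IsCutoff ψ) =>
    bandBound_lineTerm_of_contDiff hE hE0 hE0' hK1 hK hf hψ
  have hD := fun ψ (hψ : IsCutoff ψ) d =>
    bandBound_bulkTerm_of_contDiff_one hE hE0 hE0' hK1 hK (hd d) hψ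
  have h1 := fun ψ (hψ : IsCutoff ψ) =>
    bandBound_bulkTerm_of_contDiff_one hE hE0 hE0' hK1 hK hf1 hψ
  have aux : ∀ N σ : ℝ, 6 ≤ N → K ≤ σ → σ ≤ 2 * N → 0 < N ∧ 0 < σ ∧ 1 / N ≤ 2 / σ ∧
      1 / σ ≤ 1 := fun N σ hN hσ hσ2 => by
    have h1 : 0 < N := by linarith
    have h2 : 0 < σ := by linarith
    refine ⟨h1, h2, ?_, ?_⟩
    · rw [div_le_div_iff₀ h1 h2]; linarith
    · rw [div_le_one h2]; linarith
  have h2 : ∀ ψ, IsCutoff ψ → BandBound K (fun N _ => bulkTerm E f ψ N) fun N σ => 1 / (N * σ) :=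
    fun ψ hψ => .of_step (c := 21) hE1 hf1 hψ (hL ψ hψ) (hD ψ hψ)
      (fun d => h1 _ (hψ.dirDeriv d)) (by norm_num) fun N σ hN hσ _ hσ2 => by
        obtain ⟨a1, a2, a3, a4⟩ := aux N σ hN hσ hσ2
        have e : N ^ 2 * (1 / (N * σ)) ^ 2 = (1 / σ) ^ 2 := by field_simp
        rw [e, div_eq_mul_one_div _ (N ^ 2), ← one_div_pow, ← one_div_pow]
        have b1 : (1 / σ) ^ 2 ≤ 1 := pow_le_one₀ (by positivity) a4
        have b2 : (1 / N) ^ 2 ≤ (2 / σ) ^ 2 := pow_le_pow_left₀ (by positivity) a3 2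
        have e2 : (2 / σ) ^ 2 = 4 * (1 / σ) ^ 2 := by ring
        nlinarith [sq_nonneg (1 / σ), sq_nonneg (1 / N)]
  exact .of_step (c := 21) hE1 hf1 hψ (hL ψ hψ) (hD ψ hψ)
      (fun d => h2 _ (hψ.dirDeriv d)) (by norm_num) fun N σ hN hσ _ hσ2 => by
        obtain ⟨a1, a2, a3, a4⟩ := aux N σ hN hσ hσ2
        have e : N ^ 2 * (1 / (N * σ ^ 2)) ^ 2 = ((1 / σ) ^ 2) ^ 2 := by field_simp
        have e1 : (1 / (N * σ)) ^ 2 = (1 / N) ^ 2 * (1 / σ) ^ 2 := by field_simp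
        rw [e, e1, div_eq_mul_one_div _ (N ^ 2), ← one_div_pow, ← one_div_pow]
        have b2 : (1 / N) ^ 2 ≤ (2 / σ) ^ 2 := pow_le_pow_left₀ (by positivity) a3 2
        have e2 : (2 / σ) ^ 2 = 4 * (1 / σ) ^ 2 := by ring
        nlinarith [sq_nonneg (1 / σ), sq_nonneg (1 / N)]

lemma norm_lineTerm_le (hE : ContDiff ℝ 2 E) (hE0 : E 0 = 0) (hE0' : deriv E 0 = 0)
    (hf : Continuous f) (hψ : IsCutoff ψ) :
    ∃ C ≥ 0, ∀ (c : Config) t,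
      ‖lineTerm E f ψ c.N c.p (linePoint c.p c.q c.ν t)‖ ≤ C := by
  have hA := unifC_amplitude (n := 0) (by norm_num) hE hE0 (by simpa using hf) hψ
  have hF : UnifC 0 _ := (unifC_slope hE hE0').1
  obtain ⟨_, M1, hM1, b1⟩ := hA.bdd
  obtain ⟨_, M2, hM2, b2⟩ := (hF.mul hA).bdd
  refine ⟨2 * (8 * M1) + 1 * (8 * M2), by positivity, fun c t => ?_⟩
  rw [lineTerm_eq_oscInt hE hE0 hE0' hf hψ c t]
  refine (norm_sub_le _ _).trans ?_
  rw [norm_mul, norm_mul, Complex.norm_real, Complex.norm_real]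
  have h3 : ‖c.p.2 / c.N‖ ≤ 1 := by
    rw [norm_div, Real.norm_eq_abs, Real.norm_of_nonneg c.adm.pos.le]
    refine div_le_one_of_le₀ ?_ c.adm.pos.le
    linarith [c.adm.abs_snd_le, c.adm.le_scale]
  gcongr
  · exact c.adm.abs_fst_le
  · exact norm_oscInt_le (b1 c) t
  · exact norm_oscInt_le (b2 c) t

/-- Uniform bound for the band integrals in all directions. -/
lemma setIntegral_norm_bulkTerm_le (hE : ContDiff ℝ 2 E) (hE0 : E 0 = 0) (hE0' : deriv E 0 = 0)
    (hf : ContDiff ℝ 2 f) (hψ : IsCutoff ψ) :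
    ∃ C ≥ 0, ∀ N p q ν, IsAdmissible N p q ν →
      ∫ t in band N, ‖bulkTerm E f ψ N (linePoint p q ν t)‖ ^ 2 ≤
        C * N⁻¹ * ((1 + N * |p.2|) ^ 5)⁻¹ := by
  have hf1 : ContDiff ℝ 1 f := hf.of_le (by norm_num)
  have hE1 : ContDiff ℝ 1 E := hE.of_le (by norm_num)
  obtain ⟨K, hK1, hK⟩ := exists_isPhase hE hE0'
  obtain ⟨C1, hC1, hb⟩ := (bandBound_bulkTerm_of_contDiff_two hE hE0 hE0' hK1 hK hf hψ).bound
  obtain ⟨L, hL, bL⟩ := norm_lineTerm_le hE hE0 hE0' hf.continuous hψ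
  have hd : ∀ d, Continuous (dirDeriv d f) := fun d =>
    (contDiff_dirDeriv (n := 0) (by simpa using hf1) d).continuous
  obtain ⟨A1, hA1, bA1⟩ := norm_bulkTerm_le (E := E) (hd (1, 0)) hψ
  obtain ⟨A2, hA2, bA2⟩ := norm_bulkTerm_le (E := E) (hd (0, 1)) hψ
  obtain ⟨A3, hA3, bA3⟩ := norm_bulkTerm_le (E := E) hf.continuous (hψ.dirDeriv (1, 0))
  obtain ⟨A4, hA4, bA4⟩ := norm_bulkTerm_le (E := E) hf.continuous (hψ.dirDeriv (0, 1))
  set S := L ^ 2 + 1 * A1 ^ 2 + 1 * A2 ^ 2 + A3 ^ 2 + A4 ^ 2 with hS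
  refine ⟨C1 * 2 ^ 5 + 3 * 2880 * S * (1 + K) ^ 5, by positivity, fun N p q ν h => ?_⟩
  have hN := h.pos
  set σ := N * |p.2| with hσ
  have hσ0 : 0 ≤ σ := by positivity
  by_cases hp : K ≤ σ
  · refine (hb N p q ν h hp).trans ?_
    have hσ1 : 0 < σ := by linarith
    have hP : 0 < |p.2| := pos_of_mul_pos_right hσ1 hN.le
    have h1 : (1 + σ) ^ 5 ≤ (2 * σ) ^ 5 := pow_le_pow_left₀ (by positivity) (by linarith) 5
    have e : C1 * (1 / (N * σ ^ 2)) ^ 2 / |p.2| = C1 * N⁻¹ * (σ ^ 5)⁻¹ := by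
      rw [hσ]; field_simp
    rw [e]
    have h2 : (σ ^ 5)⁻¹ ≤ 2 ^ 5 * ((1 + σ) ^ 5)⁻¹ := by
      rw [← div_eq_mul_inv, le_div_iff₀ (by positivity), inv_mul_le_iff₀ (by positivity)]
      linarith [mul_pow 2 σ 5]
    calc C1 * N⁻¹ * (σ ^ 5)⁻¹ ≤ C1 * N⁻¹ * (2 ^ 5 * ((1 + σ) ^ 5)⁻¹) := by gcongr
      _ = C1 * 2 ^ 5 * N⁻¹ * ((1 + σ) ^ 5)⁻¹ := by ring
      _ ≤ _ := by
        gcongr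
        linarith [show 0 ≤ 3 * 2880 * S * (1 + K) ^ 5 by positivity]
  · push Not at hp
    have h1N : 1 ≤ N := by linarith [h.le_scale]
    have hN2 : 1 / N ^ 2 ≤ 1 := by
      rw [div_le_one (by positivity)]; exact one_le_pow₀ h1N
    have hpt : ∀ t ∈ band N, ‖bulkTerm E f ψ N (linePoint p q ν t)‖ ^ 2 ≤ 2880 / N ^ 2 * S := by
      intro t ht
      refine (norm_sq_bulkTerm_le hE1 hf1 hψ h ht).trans ?_
      have b0 : ‖lineTerm E f ψ N p (linePoint p q ν t)‖ ≤ L := bL ⟨N, p, q, ν, h⟩ t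
      rw [hS]
      gcongr
      · exact bA1 _ _ h1N
      · exact bA2 _ _ h1N
      · exact bA3 _ _ h1N
      · exact bA4 _ _ h1N
    refine (setIntegral_band_const_le hN.le (by positivity) hpt
      (integrableOn_band_comp_linePoint (continuous_bulkTerm hf.continuous hψ N) p q ν N)).trans ?_
    have h2 : 1 ≤ (1 + K) ^ 5 * ((1 + σ) ^ 5)⁻¹ := by
      rw [← div_eq_mul_inv, one_le_div (by positivity)]
      gcongr
    calc 3 * N * (2880 / N ^ 2 * S) = 3 * 2880 * S * N⁻¹ * 1 := by field_simp
      _ ≤ 3 * 2880 * S * N⁻¹ * ((1 + K) ^ 5 * ((1 + σ) ^ 5)⁻¹) := by gcongr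
      _ = 3 * 2880 * S * (1 + K) ^ 5 * N⁻¹ * ((1 + σ) ^ 5)⁻¹ := by ring
      _ ≤ _ := by
        gcongr
        linarith [show 0 ≤ C1 * 2 ^ 5 by positivity]

end

lemma hasDerivAt_integral_mul_cexp {h : ℝ × ℝ → ℂ} {s d : ℝ × ℝ → ℝ} (hh : Integrable h)
    (hd : Integrable fun u => (d u : ℂ) * h u) (hs : Continuous s) (hdc : Continuous d) (t : ℝ) :
    HasDerivAt (fun t : ℝ => ∫ u, h u * Complex.exp (-Complex.I * ((d u * t + s u : ℝ) : ℂ)))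
      (∫ u, (-Complex.I * (d u : ℂ) * h u) *
        Complex.exp (-Complex.I * ((d u * t + s u : ℝ) : ℂ))) t := by
  have hexp : ∀ x : ℝ, ‖Complex.exp (-Complex.I * (x : ℂ))‖ = 1 := fun x => by
    rw [neg_mul]; exact norm_exp_neg_I_mul x
  refine (hasDerivAt_integral_of_dominated_loc_of_deriv_le (s := univ)
    (bound := fun u => ‖(d u : ℂ) * h u‖)
    (F' := fun (t : ℝ) u => (-Complex.I * (d u : ℂ) * h u) *
        Complex.exp (-Complex.I * ((d u * t + s u : ℝ) : ℂ)))
    Filter.univ_mem (Filter.Eventually.of_forall fun x => ?_) ?_ ?_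
    (Filter.Eventually.of_forall fun u x _ => ?_) hd.norm
    (Filter.Eventually.of_forall fun u x _ => ?_)).2
  · exact hh.aestronglyMeasurable.mul
      (by fun_prop : Continuous fun u => Complex.exp
        (-Complex.I * ((d u * x + s u : ℝ) : ℂ))).aestronglyMeasurable
  · refine hh.mul_bdd (c := 1) (by fun_prop : Continuous fun u => Complex.exp
        (-Complex.I * ((d u * t + s u : ℝ) : ℂ))).aestronglyMeasurable ?_
    exact Filter.Eventually.of_forall fun u => (hexp _).le
  · simp only [mul_assoc (-Complex.I)]
    exact (hd.aestronglyMeasurable.mul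
      (by fun_prop : Continuous fun u => Complex.exp
        (-Complex.I * ((d u * t + s u : ℝ) : ℂ))).aestronglyMeasurable).const_mul _
  · rw [norm_mul, hexp, mul_one, mul_assoc, norm_mul, norm_neg, Complex.norm_I, one_mul]
  · have h1 : HasDerivAt (fun x : ℝ => ((d u * x + s u : ℝ) : ℂ)) (d u : ℂ) x := by
      have := (((hasDerivAt_id x).const_mul (d u)).add_const (s u)).ofReal_comp
      simpa using this
    refine ((h1.const_mul (-Complex.I)).cexp.const_mul (h u)).congr_deriv ?_
    ring

lemma pd1_FT {h : ℝ × ℝ → ℂ} (hh : Integrable h) (hd : Integrable fun u => (u.1 : ℂ) * h u) :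
    pd1 (FT h) = FT fun u => -Complex.I * (u.1 : ℂ) * h u := by
  funext x
  have := (hasDerivAt_integral_mul_cexp (s := fun u => u.2 * x.2) (d := Prod.fst) hh hd
    (by fun_prop) (by fun_prop) x.1).const_mul (((2 * π) ^ 2 : ℂ)⁻¹)
  exact this.deriv

lemma pd2_FT {h : ℝ × ℝ → ℂ} (hh : Integrable h) (hd : Integrable fun u => (u.2 : ℂ) * h u) :
    pd2 (FT h) = FT fun u => -Complex.I * (u.2 : ℂ) * h u := by
  funext x
  have := (hasDerivAt_integral_mul_cexp (s := fun u => u.1 * x.1) (d := Prod.snd) hh hd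
    (by fun_prop) (by fun_prop) x.2).const_mul (((2 * π) ^ 2 : ℂ)⁻¹)
  simp only [add_comm _ (_ * x.1)] at this
  exact this.deriv

lemma pd_FT {h : ℝ × ℝ → ℂ} (hh : ∀ a b : ℕ, Integrable fun u => (u.1 : ℂ) ^ a * (u.2 : ℂ) ^ b * h u)
    (r : ℕ × ℕ) :
    pd r (FT h) = FT fun u =>
      (-Complex.I) ^ (r.1 + r.2) * ((u.1 : ℂ) ^ r.1 * (u.2 : ℂ) ^ r.2 * h u) := by
  have h2 : ∀ b : ℕ, pd2^[b] (FT h) = FT fun u => (-Complex.I) ^ b * ((u.2 : ℂ) ^ b * h u) := by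
    intro b
    induction b with
    | zero => simp
    | succ b ih =>
      rw [Function.iterate_succ_apply', ih, pd2_FT]
      · congr 1; funext u; ring
      · exact ((hh 0 b).const_mul ((-Complex.I) ^ b)).congr (.of_forall fun u => by simp)
      · exact ((hh 0 (b + 1)).const_mul ((-Complex.I) ^ b)).congr
          (.of_forall fun u => by ring)
  obtain ⟨a, b⟩ := r
  simp only [pd]
  induction a with
  | zero => simp [h2]
  | succ a ih =>
    rw [Function.iterate_succ_apply', ih, pd1_FT]
    · congr 1; funext u; ring
    · exact (hh a b).const_mul _
    · exact ((hh (a + 1) b).const_mul ((-Complex.I) ^ (a + b))).congr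
          (.of_forall fun u => by ring)

lemma FT_const_mul (z : ℂ) (h : ℝ × ℝ → ℂ) (x : ℝ × ℝ) :
    FT (fun u => z * h u) x = z * FT h x := by
  simp only [FT, mul_assoc, integral_const_mul]
  ring

lemma IsCutoff.monomial_mul {φ : ℝ × ℝ → ℝ} (hφ : IsCutoff φ) (a b : ℕ) :
    IsCutoff fun u => u.1 ^ a * u.2 ^ b * φ u where
  smooth := by
    have := hφ.smooth
    fun_prop
  supp := (tsupport_mul_subset_right (f := fun u : ℝ × ℝ => u.1 ^ a * u.2 ^ b)).trans hφ.supp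

lemma FT_edgeFragment {E : ℝ → ℝ} {f φ : ℝ × ℝ → ℝ} (hE : Continuous E) (j : ℕ) (x : ℝ × ℝ)
    {N : ℝ} (hN : N = (2 : ℝ) ^ ((j : ℝ) / 2)) :
    FT (fun u => (edgeFragment f φ E j u : ℂ)) x =
      ((2 * π) ^ 2 : ℂ)⁻¹ * ((((N ^ 2)⁻¹ : ℝ) : ℂ) * bulkTerm E f φ N (N⁻¹ • x)) := by
  have hN0 : 0 < N := by rw [hN]; positivity
  rw [FT]
  congr 1
  have hcv := Measure.integral_comp_smul (volume : Measure (ℝ × ℝ))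
    (fun u => (edgeFragment f φ E j u : ℂ) *
      Complex.exp (-(Complex.I) * ((u.1 * x.1 + u.2 * x.2 : ℝ) : ℂ))) N⁻¹
  have hfr : Module.finrank ℝ (ℝ × ℝ) = 2 := by simp
  have he : |((N⁻¹) ^ 2)⁻¹| = N ^ 2 := by
    rw [inv_pow, inv_inv, abs_of_pos (by positivity)]
  have hN2 : ((N ^ 2 : ℝ) : ℂ) ≠ 0 := by exact_mod_cast (by positivity : N ^ 2 ≠ 0)
  rw [hfr, he, Complex.real_smul, ← inv_mul_eq_iff_eq_mul₀ hN2] at hcv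
  rw [← hcv, bulkTerm, edgeBulk,
    ← integral_indicator (measurableSet_region (continuous_scaledCurve hE N)), Complex.ofReal_inv]
  congr 2
  funext u
  have hset : (E (N⁻¹ * u.2) ≤ N⁻¹ * u.1) ↔ scaledCurve E N u.2 ≤ u.1 := by
    rw [scaledCurve, le_inv_mul_iff₀ hN0]
  simp only [edgeFragment, indicator, mem_ofPred_eq, Prod.smul_fst, Prod.smul_snd, smul_eq_mul,
    hset, ← hN, mul_inv_cancel_left₀ hN0.ne']
  split_ifs
  · rw [mul_one, neg_mul]
    congr 5
    ring
  · simp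

lemma integrable_edgeFragment {E : ℝ → ℝ} {f φ : ℝ × ℝ → ℝ} (hE : Continuous E)
    (hf : Continuous f) (hφ : IsCutoff φ) (j : ℕ) :
    Integrable fun u => (edgeFragment f φ E j u : ℂ) := by
  have hN : (2 : ℝ) ^ ((j : ℝ) / 2) ≠ 0 := by positivity
  have h1 : HasCompactSupport fun u : ℝ × ℝ => φ ((2 : ℝ) ^ ((j : ℝ) / 2) • u) :=
    hφ.hasCompactSupport.comp_smul hN
  have h2 := hφ.smooth.continuous
  have h3 : Integrable fun u : ℝ × ℝ => f u * φ ((2 : ℝ) ^ ((j : ℝ) / 2) • u) :=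
    (by fun_prop : Continuous _).integrable_of_hasCompactSupport h1.mul_left
  refine ((h3.indicator (measurableSet_region hE)).ofReal (𝕜 := ℂ)).congr (.of_forall fun u => ?_)
  simp only [edgeFragment, indicator, mem_ofPred_eq]
  split_ifs <;> simp [Prod.smul_def]

lemma norm_pd_FT_edgeFragment {E : ℝ → ℝ} {f φ : ℝ × ℝ → ℝ} (hE : Continuous E)
    (hf : Continuous f) (hφ : IsCutoff φ) (r : ℕ × ℕ) (j : ℕ) (x : ℝ × ℝ) {N : ℝ}
    (hN : N = (2 : ℝ) ^ ((j : ℝ) / 2)) :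
    ‖pd r (FT fun u => (edgeFragment f φ E j u : ℂ)) x‖ ^ 2 =
      ((2 * π) ^ 4)⁻¹ * (N ^ (4 + 2 * (r.1 + r.2)))⁻¹ *
        ‖bulkTerm E f (fun u => u.1 ^ r.1 * u.2 ^ r.2 * φ u) N (N⁻¹ • x)‖ ^ 2 := by
  have hN0 : 0 < N := by rw [hN]; positivity
  have key : ∀ a b : ℕ, (fun u : ℝ × ℝ => (u.1 : ℂ) ^ a * (u.2 : ℂ) ^ b *
      (edgeFragment f φ E j u : ℂ)) = fun u => (((N ^ (a + b))⁻¹ : ℝ) : ℂ) *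
        (edgeFragment f (fun u => u.1 ^ a * u.2 ^ b * φ u) E j u : ℂ) := by
    intro a b
    funext u
    simp only [edgeFragment, ← hN]
    have hNc : (N : ℂ) ≠ 0 := by exact_mod_cast hN0.ne'
    push_cast
    field_simp
    rw [mul_pow, mul_pow]
    ring
  have hintg : ∀ a b : ℕ, Integrable fun u : ℝ × ℝ => (u.1 : ℂ) ^ a * (u.2 : ℂ) ^ b *
      (edgeFragment f φ E j u : ℂ) := fun a b => by
    rw [key]
    exact (integrable_edgeFragment hE hf (hφ.monomial_mul a b) j).const_mul _
  rw [pd_FT hintg, FT_const_mul, key, FT_const_mul, FT_edgeFragment hE j x hN]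
  simp only [norm_mul, norm_pow, norm_inv, norm_neg, Complex.norm_I, Complex.norm_real, one_pow,
    Complex.norm_ofNat, Real.norm_of_nonneg hN0.le, Real.norm_of_nonneg pi_pos.le]
  field_simp
  ring

namespace IsWindow

variable {g : ℝ → ℝ}

lemma eq_zero (hg : IsWindow g) {x : ℝ} (hx : 2 / 3 ≤ |x|) : g x = 0 := by
  by_contra h
  have h1 : x ∈ Function.support g := h
  rw [hg.supp_eq] at h1
  exact absurd (_root_.abs_lt.2 h1) (not_lt.2 hx)

lemma eq_one (hg : IsWindow g) {x : ℝ} (hx : |x| ≤ 1 / 3) : g x = 1 := by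
  have h1 := hg.partition x
  have h2 : HasSum (fun z : ℤ => g (x + (z : ℝ))) (g (x + ((0 : ℤ) : ℝ))) := by
    refine hasSum_single 0 fun z hz => hg.eq_zero ?_
    have h3 : (1 : ℝ) ≤ |(z : ℝ)| := by exact_mod_cast Int.one_le_abs hz
    have h4 : |(z : ℝ)| ≤ |x + z| + |x| := by
      simpa using abs_sub (x + z) x
    linarith
  simpa using h2.unique h1

lemma gtilde_eq_zero (hg : IsWindow g) {x : ℝ} (hx : |x| < 1 / 3 ∨ 4 / 3 < |x|) :
    gtilde g x = 0 := by
  have e : |x / 2| = |x| / 2 := by rw [abs_div, abs_two]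
  rcases hx with hx | hx
  · rw [gtilde, hg.eq_one hx.le, hg.eq_one (by rw [e]; linarith [abs_nonneg x]), sub_self]
  · rw [gtilde, hg.eq_zero (by rw [e]; linarith), hg.eq_zero (by linarith), sub_self]

lemma mem_of_mul_ne_zero (hg : IsWindow g) {x y N : ℝ} (hN : 0 < N)
    (h : gtilde g x * g y ≠ 0) : N * x ∈ band N ∧ y ∈ Icc (-1 : ℝ) 1 := by
  have h1 : gtilde g x ≠ 0 := left_ne_zero_of_mul h
  have h2 : y ∈ Function.support g := right_ne_zero_of_mul h
  rw [hg.supp_eq] at h2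
  have h3 : ¬ (|x| < 1 / 3 ∨ 4 / 3 < |x|) := fun h => h1 (hg.gtilde_eq_zero h)
  push Not at h3
  refine ⟨?_, by linarith [h2.1], by linarith [h2.2]⟩
  constructor
  · rw [abs_mul, abs_of_pos hN]; nlinarith
  · rw [abs_mul, abs_of_pos hN]; nlinarith

end IsWindow

/-- The principal direction of a shearlet of slope `m`. -/
def mainDir (i : Bool) (m : ℝ) : ℝ × ℝ := if i then (1, m) else (m, 1)

/-- The transversal direction of a shearlet. -/
def crossDir (i : Bool) : ℝ × ℝ := if i then (0, 1) else (1, 0)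

lemma support_PsiJL_subset {g : ℝ → ℝ} (hg : IsWindow g) (i : Bool) (j : ℕ) (ℓ : ℤ) {N : ℝ}
    (hN : N = (2 : ℝ) ^ ((j : ℝ) / 2)) :
    Function.support (PsiJL g i j ℓ) ⊆
      (fun z : ℝ × ℝ => N • linePoint (mainDir i (ℓ * N⁻¹)) (crossDir i) z.1 z.2) ''
        (Icc (-1 : ℝ) 1 ×ˢ band N) := by
  have hN0 : 0 < N := by rw [hN]; positivity
  have e1 : (2 : ℝ) ^ (-(j : ℝ) / 2) = N⁻¹ := by
    rw [hN, ← Real.rpow_neg (by norm_num), neg_div]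
  have e2 : (2 : ℝ) ^ (-(j : ℝ)) = N⁻¹ * N⁻¹ := by
    rw [← e1, ← Real.rpow_add (by norm_num)]; ring_nf
  intro ξ hξ
  rw [Function.mem_support, PsiJL, e1, e2] at hξ
  cases i
  · have h : gtilde g (N⁻¹ * N⁻¹ * ξ.2) * g (N⁻¹ * ξ.1 - ℓ * (N⁻¹ * N⁻¹) * ξ.2) ≠ 0 := by
      rw [mul_comm]; simpa [PsiV] using hξ
    obtain ⟨h1, h2⟩ := hg.mem_of_mul_ne_zero hN0 h
    refine ⟨(_, _), ⟨h2, h1⟩, ?_⟩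
    ext <;> simp [linePoint, mainDir, crossDir] <;> field_simp
    ring
  · have h : gtilde g (N⁻¹ * N⁻¹ * ξ.1) * g (N⁻¹ * ξ.2 - ℓ * (N⁻¹ * N⁻¹) * ξ.1) ≠ 0 := by
      simpa [PsiH] using hξ
    obtain ⟨h1, h2⟩ := hg.mem_of_mul_ne_zero hN0 h
    refine ⟨(_, _), ⟨h2, h1⟩, ?_⟩
    ext <;> simp [linePoint, mainDir, crossDir] <;> field_simp
    ring

lemma setIntegral_image_linePoint {p q : ℝ × ℝ} {N : ℝ} (hN : 0 < N)
    (hpq : |q.1 * p.2 - p.1 * q.2| = 1) {s : Set (ℝ × ℝ)} (hs : MeasurableSet s)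
    (G : ℝ × ℝ → ℝ) :
    ∫ ξ in (fun z : ℝ × ℝ => N • linePoint p q z.1 z.2) '' s, G ξ =
      N ^ 2 * ∫ z in s, G (N • linePoint p q z.1 z.2) := by
  set L : (ℝ × ℝ) →ₗ[ℝ] (ℝ × ℝ) :=
    Matrix.toLin (Module.Basis.finTwoProd ℝ) (Module.Basis.finTwoProd ℝ)
      !![N * q.1, N * p.1; N * q.2, N * p.2] with hL
  have hLa : ∀ z, L z = N • linePoint p q z.1 z.2 := fun z => by
    rw [hL, Matrix.toLin_finTwoProd_apply]
    ext <;> simp [linePoint] <;> ring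
  have hdet : LinearMap.det L = N ^ 2 * (q.1 * p.2 - p.1 * q.2) := by
    rw [hL, LinearMap.det_toLin, Matrix.det_fin_two_of]; ring
  have habs : |LinearMap.det L| = N ^ 2 := by
    rw [hdet, abs_mul, hpq, mul_one, abs_of_pos (by positivity)]
  have hinj : Function.Injective L := by
    have hu : LinearMap.det L ≠ 0 := by
      rw [← abs_pos, habs]; positivity
    exact (LinearMap.equivOfDetNeZero L hu).injective
  have hcv := integral_image_eq_integral_abs_det_fderiv_smul volume hs
    (f := L) (f' := fun _ => LinearMap.toContinuousLinearMap L)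
    (fun x _ => (LinearMap.toContinuousLinearMap L).hasFDerivWithinAt) hinj.injOn G
  have hf : (fun z : ℝ × ℝ => N • linePoint p q z.1 z.2) = L := funext fun z => (hLa z).symm
  rw [hf, hcv]
  simp only [LinearMap.det_toContinuousLinearMap, habs, smul_eq_mul, integral_const_mul, hLa]

lemma rotT_smul_linePoint (γ N : ℝ) (p q : ℝ × ℝ) (ν t : ℝ) :
    rotT γ (N • linePoint p q ν t) = N • linePoint (rotT γ p) (rotT γ q) ν t := by
  ext <;> simp [rotT, linePoint] <;> ring

lemma rotT_sq_add_sq (γ : ℝ) (p : ℝ × ℝ) :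
    (rotT γ p).1 ^ 2 + (rotT γ p).2 ^ 2 = p.1 ^ 2 + p.2 ^ 2 := by
  simp only [rotT]
  linear_combination (p.1 ^ 2 + p.2 ^ 2) * sin_sq_add_cos_sq γ

lemma abs_sin_le_abs_rotT (i : Bool) (j : ℕ) (ℓ : ℤ) (γ : ℝ) {N : ℝ}
    (hN : N = (2 : ℝ) ^ ((j : ℝ) / 2)) :
    |Real.sin (thetaJL i j ℓ - γ)| ≤ |(rotT γ (mainDir i (ℓ * N⁻¹))).2| := by
  have e1 : (2 : ℝ) ^ (-(j : ℝ) / 2) = N⁻¹ := by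
    rw [hN, ← Real.rpow_neg (by norm_num), neg_div]
  set m := (ℓ : ℝ) * N⁻¹ with hm
  have hs : 1 ≤ Real.sqrt (1 + m ^ 2) := Real.one_le_sqrt.2 (by nlinarith [sq_nonneg m])
  have key : Real.sin (thetaJL i j ℓ - γ) * Real.sqrt (1 + m ^ 2) = (rotT γ (mainDir i m)).2 := by
    rw [thetaJL, e1, ← hm, Real.sin_sub]
    cases i
    · simp only [Bool.false_eq_true, if_false, Real.sin_pi_div_two_sub, Real.cos_pi_div_two_sub,
        Real.sin_arctan, Real.cos_arctan, rotT, mainDir]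
      field_simp
      ring
    · simp only [if_true, Real.sin_arctan, Real.cos_arctan, rotT, mainDir]
      field_simp
      ring
  rw [← key, abs_mul]
  exact le_mul_of_one_le_right (abs_nonneg _) (hs.trans (le_abs_self _))

lemma isAdmissible_rotT (i : Bool) (j : ℕ) (hj : 10 ≤ j) (ℓ : ℤ) (γ : ℝ) {N ν : ℝ}
    (hN : N = (2 : ℝ) ^ ((j : ℝ) / 2)) (hℓ : |(ℓ : ℝ)| ≤ N) (hν : ν ∈ Icc (-1 : ℝ) 1) :
    IsAdmissible N (rotT γ (mainDir i (ℓ * N⁻¹))) (rotT γ (crossDir i)) ν := by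
  have hN6 : 6 ≤ N := by
    have h1 : (2 : ℝ) ^ (5 : ℝ) ≤ N := by
      rw [hN]
      refine Real.rpow_le_rpow_of_exponent_le (by norm_num) ?_
      have : (10 : ℝ) ≤ j := by exact_mod_cast hj
      linarith
    norm_num at h1
    linarith
  have hN0 : 0 < N := by linarith
  have hm : ((ℓ : ℝ) * N⁻¹) ^ 2 ≤ 1 := by
    rw [← sq_abs, abs_mul, abs_inv, abs_of_pos hN0]
    exact pow_le_one₀ (by positivity) (by rw [← div_eq_mul_inv]; exact div_le_one_of_le₀ hℓ hN0.le)
  have e : (mainDir i (ℓ * N⁻¹)).1 ^ 2 + (mainDir i (ℓ * N⁻¹)).2 ^ 2 = 1 + ((ℓ : ℝ) * N⁻¹) ^ 2 := by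
    cases i <;> simp [mainDir] ; ring
  have e' : (crossDir i).1 ^ 2 + (crossDir i).2 ^ 2 = 1 := by
    cases i <;> simp [crossDir]
  refine ⟨hN6, ?_, ?_, ?_, abs_le.2 hν⟩
  · rw [rotT_sq_add_sq, e]; nlinarith [sq_nonneg ((ℓ : ℝ) * N⁻¹)]
  · rw [rotT_sq_add_sq, e]; linarith
  · rw [rotT_sq_add_sq, e']

lemma continuous_rotT (γ : ℝ) : Continuous (rotT γ) := by
  unfold rotT; fun_prop

lemma setIntegral_support_norm_sq_le {g : ℝ → ℝ} (hg : IsWindow g) (i : Bool) {j : ℕ}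
    (hj : 10 ≤ j) {ℓ : ℤ} {N : ℝ} (hN : N = (2 : ℝ) ^ ((j : ℝ) / 2)) (hℓ : |(ℓ : ℝ)| ≤ N) (γ : ℝ)
    {B : ℝ × ℝ → ℂ} (hB : Continuous B) {D : ℝ}
    (hD : ∀ p q ν, IsAdmissible N p q ν →
      |Real.sin (thetaJL i j ℓ - γ)| ≤ |p.2| → ∫ t in band N, ‖B (linePoint p q ν t)‖ ^ 2 ≤ D) :
    ∫ ξ in Function.support (PsiJL g i j ℓ), ‖B (N⁻¹ • rotT γ ξ)‖ ^ 2 ≤ N ^ 2 * (2 * D) := by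
  have hN0 : 0 < N := by rw [hN]; positivity
  have hrot := continuous_rotT γ
  set p := mainDir i (ℓ * N⁻¹)
  set q := crossDir i
  set R := Icc (-1 : ℝ) 1 ×ˢ band N with hR
  have hRc : IsCompact R := isCompact_Icc.prod (isCompact_band N)
  have hpq : |q.1 * p.2 - p.1 * q.2| = 1 := by
    cases i <;> simp [p, q, mainDir, crossDir]
  have hLc : Continuous fun z : ℝ × ℝ => N • linePoint p q z.1 z.2 := by
    unfold linePoint; fun_prop
  have hXc : Continuous fun ξ => ‖B (N⁻¹ • rotT γ ξ)‖ ^ 2 := by fun_prop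
  have h1 : ∫ ξ in Function.support (PsiJL g i j ℓ), ‖B (N⁻¹ • rotT γ ξ)‖ ^ 2 ≤
      ∫ ξ in (fun z : ℝ × ℝ => N • linePoint p q z.1 z.2) '' R, ‖B (N⁻¹ • rotT γ ξ)‖ ^ 2 :=
    setIntegral_mono_set (hXc.continuousOn.integrableOn_compact (hRc.image hLc))
      (.of_forall fun ξ => by positivity) (support_PsiJL_subset hg i j ℓ hN).eventuallyLE
  refine h1.trans ?_
  rw [setIntegral_image_linePoint hN0 hpq hRc.isClosed.measurableSet]
  simp only [rotT_smul_linePoint, inv_smul_smul₀ hN0.ne']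
  refine mul_le_mul_of_nonneg_left ?_ (by positivity)
  have hYc : Continuous fun z : ℝ × ℝ => ‖B (linePoint (rotT γ p) (rotT γ q) z.1 z.2)‖ ^ 2 := by
    unfold linePoint; fun_prop
  rw [hR, Measure.volume_eq_prod,
    setIntegral_prod _ (hYc.continuousOn.integrableOn_compact hRc)]
  refine (le_abs_self _).trans ?_
  rw [← Real.norm_eq_abs]
  refine (norm_setIntegral_le_of_norm_le_const (C := D) (by simp) fun ν hν => ?_).trans ?_
  · rw [Real.norm_of_nonneg (integral_nonneg fun t => by positivity)]
    exact hD _ _ ν (isAdmissible_rotT i j hj ℓ γ hN hℓ hν) (abs_sin_le_abs_rotT i j ℓ γ hN)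
  · rw [Real.volume_real_Icc_of_le (by norm_num)]
    linarith

/-- For `Ψ^{(i)} ∈ 𝒲₂^q`, a standard edge fragment `ℰ_j`, a rotation
`R_γ` and any multi-index `r`,
`∫_{supp Ψ_{j,ℓ}^{(i)}} |∂^r[𝓕ℰ_j](R_γᵀξ)|² dξ
  ≤ C(r) 2^{-j(3/2+|r|₁)} (1 + 2^{j/2}|sin(θ_{j,ℓ}^{(i)} − γ)|)^{-5}`. -/
theorem int_FT_edge_support (g : ℝ → ℝ) (q : ℕ) (hg : IsWindowQ g q) (i : Bool)
    (φ : ℝ × ℝ → ℝ) (hφ : ContDiff ℝ (⊤ : ℕ∞) φ)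
    (hφs : tsupport φ ⊆ Icc (-π) π ×ˢ Icc (-π) π)
    (E : ℝ → ℝ) (hE : ContDiff ℝ 2 E) (hE0 : E 0 = 0) (hE0' : deriv E 0 = 0)
    (f : ℝ × ℝ → ℝ) (hf : ContDiff ℝ 2 f) (r : ℕ × ℕ) :
    ∃ C > 0, ∀ j : ℕ, Even j → 10 ≤ j → ∀ ℓ : ℤ, |(ℓ : ℝ)| ≤ (2:ℝ)^((j:ℝ)/2) →
      ∀ γ ∈ Ico (0:ℝ) (2*π),
      (∫ ξ in Function.support (PsiJL g i j ℓ),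
          ‖pd r (FT (fun x => (edgeFragment f φ E j x : ℂ))) (rotT γ ξ)‖^2)
        ≤ C * (2:ℝ)^(-(j:ℝ)*(3/2+(r.1:ℝ)+(r.2:ℝ)))
            * (1 + (2:ℝ)^((j:ℝ)/2) * |Real.sin (thetaJL i j ℓ - γ)|)^(-(5:ℝ)) := by
  have hφ' : IsCutoff φ := ⟨hφ, hφs⟩
  obtain ⟨C, hC, hb⟩ := setIntegral_norm_bulkTerm_le hE hE0 hE0' hf (hφ'.monomial_mul r.1 r.2)
  refine ⟨2 * C + 1, by positivity, fun j _ hj ℓ hℓ γ _ => ?_⟩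
  obtain ⟨N, hN⟩ : ∃ N, N = (2 : ℝ) ^ ((j : ℝ) / 2) := ⟨_, rfl⟩
  have hN0 : 0 < N := by rw [hN]; positivity
  rw [← hN] at hℓ ⊢
  set s := |Real.sin (thetaJL i j ℓ - γ)| with hs
  have hs0 : 0 ≤ s := abs_nonneg _
  have e1 : (2 : ℝ) ^ (-(j : ℝ) * (3 / 2 + (r.1 : ℝ) + (r.2 : ℝ))) =
      (N ^ (3 + 2 * (r.1 + r.2)))⁻¹ := by
    rw [hN, ← Real.rpow_natCast, ← Real.rpow_mul (by norm_num), ← Real.rpow_neg (by norm_num)]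
    congr 1
    push_cast
    ring
  have e2 : (1 + N * s) ^ (-(5 : ℝ)) = ((1 + N * s) ^ 5)⁻¹ := by
    rw [Real.rpow_neg (by positivity)]
    norm_cast
  have hpi : ((2 * π) ^ 4)⁻¹ ≤ 1 :=
    inv_le_one_of_one_le₀ (one_le_pow₀ (by linarith [pi_gt_three]))
  rw [e1, e2]
  simp only [norm_pd_FT_edgeFragment hE.continuous hf.continuous hφ' r j _ hN, integral_const_mul]
  have key := setIntegral_support_norm_sq_le hg.1 i hj hN hℓ γ
    (continuous_bulkTerm hf.continuous (hφ'.monomial_mul r.1 r.2) N (E := E))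
    (D := C * N⁻¹ * ((1 + N * s) ^ 5)⁻¹) fun p q ν h hp => (hb N p q ν h).trans (by gcongr)
  calc _ ≤ 1 * (N ^ (4 + 2 * (r.1 + r.2)))⁻¹ *
        (N ^ 2 * (2 * (C * N⁻¹ * ((1 + N * s) ^ 5)⁻¹))) := by gcongr
    _ = 2 * C * (N ^ (3 + 2 * (r.1 + r.2)))⁻¹ * ((1 + N * s) ^ 5)⁻¹ := by
      rw [show 4 + 2 * (r.1 + r.2) = 3 + 2 * (r.1 + r.2) + 1 by ring, pow_succ]
      field_simp
    _ ≤ _ := by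
      gcongr
      linarith
end
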